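/- arXiv:1209.5096 — 2 statements merged into one kernel-verified Lean document; each statement's English description precedes it below -/
import Mathlib

section
/- Let U be a unital ring, and let A and B be n×n matrices over U such that there exist a nondegenerate diagonal matrix D over U and a matrix C over U with A = DC and B = CD. Then there exist matrices A', B' over U such that A' is an elementary row splitting of A over U, B' is an elementary column splitting of B over U, and A' is conjugate over U to B'. If in addition A and B are nondegenerate and U has no zero divisors, then A' and B' can be chosen nondegenerate. -/
open Matrix

/-- A matrix is nondegenerate if it has no zero row and no zero column. -/
def Nondeg {R : Type*} [Zero R] {m n : ℕ} (A : Matrix (Fin m) (Fin n) R) : Prop :=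
  (∀ i, ∃ j, A i j ≠ 0) ∧ (∀ j, ∃ i, A i j ≠ 0)

/-- An amalgamation matrix: a 0-1 matrix with exactly one 1 in each row and at
least one 1 in each column. -/
def IsAmalgamation {R : Type*} [Ring R] {m n : ℕ} (V : Matrix (Fin m) (Fin n) R) : Prop :=
  (∀ i j, V i j = 0 ∨ V i j = 1) ∧ (∀ i, ∃! j, V i j = 1) ∧ (∀ j, ∃ i, V i j = 1)

/-- A subdivision matrix is the transpose of an amalgamation matrix. -/
def IsSubdivision {R : Type*} [Ring R] {m n : ℕ} (U₀ : Matrix (Fin m) (Fin n) R) : Prop :=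
  IsAmalgamation U₀ᵀ

/-- `C` is an elementary row splitting over `R` of the square matrix `A`. -/
def RowSplitting {R : Type*} [Ring R] {m k : ℕ}
    (A : Matrix (Fin m) (Fin m) R) (C : Matrix (Fin k) (Fin k) R) : Prop :=
  ∃ (U₀ : Matrix (Fin m) (Fin k) R) (X : Matrix (Fin k) (Fin m) R),
    IsSubdivision U₀ ∧ A = U₀ * X ∧ C = X * U₀

/-- `C` is an elementary column splitting over `R` of the square matrix `A`. -/
def ColSplitting {R : Type*} [Ring R] {m k : ℕ}
    (A : Matrix (Fin m) (Fin m) R) (C : Matrix (Fin k) (Fin k) R) : Prop :=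
  ∃ (X : Matrix (Fin m) (Fin k) R) (V : Matrix (Fin k) (Fin m) R),
    IsAmalgamation V ∧ A = X * V ∧ C = V * X

/-- Matrices `A`, `B` of size `p` over `R` are conjugate over `R`. -/
def ConjOver {R : Type*} [Ring R] {p : ℕ} (A B : Matrix (Fin p) (Fin p) R) : Prop :=
  ∃ W Winv : Matrix (Fin p) (Fin p) R, W * Winv = 1 ∧ Winv * W = 1 ∧ Winv * A * W = B

/-- The 0-1 matrix of a map `f`, with a `1` at `(i, f i)` for every `i`. -/
def mapMatrix (R : Type*) [Ring R] {ι κ : Type*} [DecidableEq κ] (f : ι → κ) : Matrix ι κ R :=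
  (1 : Matrix κ κ R).submatrix f id

theorem mapMatrix_apply {R : Type*} [Ring R] {ι κ : Type*} [DecidableEq κ] (f : ι → κ)
    (i : ι) (j : κ) : mapMatrix R f i j = if f i = j then 1 else 0 := by
  simp [mapMatrix, Matrix.one_apply]

theorem mapMatrix_mul {R : Type*} [Ring R] {ι κ l : Type*} [Fintype κ] [DecidableEq κ]
    (f : ι → κ) (M : Matrix κ l R) : mapMatrix R f * M = M.submatrix f id := by
  ext i j
  simp [Matrix.mul_apply, mapMatrix_apply]

theorem mul_transpose_mapMatrix {R : Type*} [Ring R] {ι κ l : Type*} [Fintype κ]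
    [DecidableEq κ] (f : ι → κ) (M : Matrix l κ R) :
    M * (mapMatrix R f)ᵀ = M.submatrix id f := by
  ext i j
  simp [Matrix.mul_apply, mapMatrix_apply]

theorem isAmalgamation_mapMatrix {R : Type*} [Ring R] [Nontrivial R] {m n : ℕ}
    {f : Fin m → Fin n} (hf : Function.Surjective f) : IsAmalgamation (mapMatrix R f) := by
  refine ⟨fun i j => ?_, fun i => ⟨f i, ?_, fun j hj => ?_⟩, fun j => ?_⟩
  · rw [mapMatrix_apply]
    split_ifs <;> simp
  · simp [mapMatrix_apply]
  · by_contra h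
    simp [mapMatrix_apply, Ne.symm h] at hj
  · obtain ⟨i, rfl⟩ := hf j
    exact ⟨i, by simp [mapMatrix_apply]⟩

/-- The weights on the split index set: an index with diagonal entry `d ≠ 1` is split into two
indices of weights `d - 1` and `1`. -/
noncomputable def splitWeight {R κ : Type*} [Ring R] (d : κ → R) : κ ⊕ {i // d i ≠ 1} → R :=
  open Classical in Sum.elim (fun i => d i - if d i ≠ 1 then 1 else 0) fun _ => 1

theorem splitWeight_ne_zero {R κ : Type*} [Ring R] [Nontrivial R] (d : κ → R)
    (x : κ ⊕ {i // d i ≠ 1}) : splitWeight d x ≠ 0 := by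
  rcases x with i | s
  · by_cases h : d i = 1
    · simp [splitWeight, h]
    · simp [splitWeight, h, sub_eq_zero]
  · simp [splitWeight]

/-- An invertible matrix carrying the amalgamation matrix of the split index set to its
weighted version, from either side. -/
theorem exists_splitWeight_intertwiner {R κ : Type*} [Ring R] [Fintype κ] [DecidableEq κ]
    (d : κ → R) [Fintype {i // d i ≠ 1}] [DecidableEq {i // d i ≠ 1}] :
    let V := mapMatrix R (Sum.elim id Subtype.val : κ ⊕ {i // d i ≠ 1} → κ)
    let T := diagonal (splitWeight d)
    Vᵀ * T * V = diagonal d ∧ ∃ W Winv : Matrix (κ ⊕ {i // d i ≠ 1}) (κ ⊕ {i // d i ≠ 1}) R,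
      W * Winv = 1 ∧ Winv * W = 1 ∧
      W * V = T * V ∧ Vᵀ * W = Vᵀ * T := by
  classical
  intro V T
  let K := mapMatrix R (Subtype.val : {i // d i ≠ 1} → κ)
  let J := Kᵀ
  let E : Matrix κ κ R := diagonal fun i => if d i ≠ 1 then 1 else 0
  let D := diagonal d
  have hKJ : K * J = 1 := by
    ext s t
    simp [K, J, mul_transpose_mapMatrix, mapMatrix_apply, Matrix.one_apply, Subtype.ext_iff]
  have hJK : J * K = E := by
    ext i j
    rw [Matrix.mul_apply]
    simp only [J, K, E, Matrix.transpose_apply, mapMatrix_apply, Matrix.diagonal_apply]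
    by_cases hi : d i = 1
    · rw [Finset.sum_eq_zero]
      · simp [hi]
      · rintro ⟨s, hs⟩ -
        have : s ≠ i := by rintro rfl; exact hs hi
        simp [this]
    · rw [Finset.sum_eq_single ⟨i, hi⟩]
      · simp [hi]
      · rintro ⟨s, hs⟩ - hne
        have : s ≠ i := by rintro rfl; exact hne rfl
        simp [this]
      · simp
  have hEJ : E * J = J := by rw [← hJK, Matrix.mul_assoc, hKJ, Matrix.mul_one]
  have hKE : K * E = K := by rw [← hJK, ← Matrix.mul_assoc, hKJ, Matrix.one_mul]
  have hV : V = fromRows 1 K := by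
    ext (i | s) j <;> rfl
  have hT : T = fromBlocks (D - E) 0 0 1 := by
    rw [← Matrix.diagonal_one, Matrix.diagonal_sub, Matrix.fromBlocks_diagonal]
    rfl
  have hVt : Vᵀ = fromCols 1 J := by
    rw [hV, Matrix.transpose_fromRows, Matrix.transpose_one]
  have hEE : E * E = E := by
    rw [← hJK, Matrix.mul_assoc, ← Matrix.mul_assoc K, hKJ, Matrix.one_mul]
  have hDE : D * E = D - 1 + E := by
    ext i j
    by_cases hij : i = j
    · subst hij
      by_cases h : d i = 1 <;> simp [D, E, h]
    · simp [D, E, hij]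
  have hED : E * D = D - 1 + E := by
    rw [← hDE]
    simp [D, E]
  have hDE1 : (D - E - E) * (1 - E) = 1 - E := by
    simp only [sub_mul, mul_sub, mul_one, hEE, hDE]
    abel
  have hED1 : (1 - E) * (D - E - E) = 1 - E := by
    simp only [sub_mul, mul_sub, one_mul, hEE, hED]
    abel
  have hcomm : E * (D - E - E) = (D - E - E) * E := by
    simp only [sub_mul, mul_sub, hDE, hED]
  refine ⟨?_, fromBlocks (D - E - E) J K 0,
    fromBlocks (1 - E) J K (-(K * (D - E - E) * J)), ?_, ?_, ?_, ?_⟩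
  · rw [hVt, hT, hV, Matrix.fromCols_mul_fromBlocks, Matrix.fromCols_mul_fromRows]
    simp [hJK, D]
  · rw [Matrix.fromBlocks_multiply, ← Matrix.fromBlocks_one]
    congr 1
    · rw [hDE1, hJK, sub_add_cancel]
    · rw [Matrix.mul_neg, ← Matrix.mul_assoc, ← Matrix.mul_assoc, hJK, hcomm,
        Matrix.mul_assoc _ E, hEJ, add_neg_cancel]
    · rw [Matrix.mul_sub, hKE, Matrix.mul_one, sub_self, Matrix.zero_mul, zero_add]
    · rw [hKJ, Matrix.zero_mul, add_zero]
  · rw [Matrix.fromBlocks_multiply, ← Matrix.fromBlocks_one]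
    congr 1
    · rw [hED1, hJK, sub_add_cancel]
    · rw [Matrix.sub_mul, hEJ, Matrix.one_mul, sub_self, Matrix.mul_zero, zero_add]
    · rw [Matrix.neg_mul, Matrix.mul_assoc _ J, hJK, Matrix.mul_assoc, ← hcomm,
        ← Matrix.mul_assoc, hKE, add_neg_cancel]
    · rw [hKJ, Matrix.mul_zero, add_zero]
  · rw [hV, hT, Matrix.fromBlocks_mul_fromRows, Matrix.fromBlocks_mul_fromRows]
    simp [hJK]
  · rw [hVt, hT, Matrix.fromCols_mul_fromBlocks, Matrix.fromCols_mul_fromBlocks]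
    simp [hJK]

/-- The same intertwiner with the split index set enumerated by `Fin p`. -/
theorem exists_fin_intertwiner {R : Type*} [Ring R] [Nontrivial R] {n : ℕ} (d : Fin n → R) :
    ∃ (p : ℕ) (f : Fin p → Fin n) (t : Fin p → R) (W Winv : Matrix (Fin p) (Fin p) R),
      Function.Surjective f ∧ (∀ i, t i ≠ 0) ∧
      (mapMatrix R f)ᵀ * diagonal t * mapMatrix R f = diagonal d ∧
      W * Winv = 1 ∧ Winv * W = 1 ∧ W * mapMatrix R f = diagonal t * mapMatrix R f ∧
      (mapMatrix R f)ᵀ * W = (mapMatrix R f)ᵀ * diagonal t := by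
  classical
  obtain ⟨hD, W, Winv, h₁, h₂, h₃, h₄⟩ := exists_splitWeight_intertwiner d
  let g : Fin n ⊕ {i // d i ≠ 1} → Fin n := Sum.elim id Subtype.val
  let e := (Fintype.equivFin (Fin n ⊕ {i // d i ≠ 1})).symm
  have hV : mapMatrix R (g ∘ e) = (mapMatrix R g).submatrix e id := rfl
  have hT : diagonal (splitWeight d ∘ e) = (diagonal (splitWeight d)).submatrix e e :=
    (Matrix.submatrix_diagonal_equiv _ e).symm
  refine ⟨_, g ∘ e, splitWeight d ∘ e, W.submatrix e e, Winv.submatrix e e,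
    fun i => ⟨e.symm (Sum.inl i), by simp [g]⟩, fun i => splitWeight_ne_zero d _, ?_, ?_, ?_,
    ?_, ?_⟩
  · rw [hV, hT, Matrix.transpose_submatrix, Matrix.submatrix_mul_equiv,
      Matrix.submatrix_mul_equiv, hD, Matrix.submatrix_id_id]
  · rw [Matrix.submatrix_mul_equiv, h₁, Matrix.submatrix_one_equiv]
  · rw [Matrix.submatrix_mul_equiv, h₂, Matrix.submatrix_one_equiv]
  · rw [hV, hT, Matrix.submatrix_mul_equiv, Matrix.submatrix_mul_equiv, h₃]
  · rw [hV, hT, Matrix.transpose_submatrix, Matrix.submatrix_mul_equiv,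
      Matrix.submatrix_mul_equiv, h₄]

/-- If `A = DC` and `B = CD` with `D` a nondegenerate diagonal matrix over a unital
ring, then some elementary row splitting `A'` of `A` is conjugate over the ring to some
elementary column splitting `B'` of `B`; if moreover `A, B` are nondegenerate and the
ring has no zero divisors, then `A', B'` can be chosen nondegenerate. -/
theorem diag_refactorization_conj (R : Type*) [Ring R] {n : ℕ}
    (A B D C : Matrix (Fin n) (Fin n) R)
    (hDdiag : D.IsDiag) (hDnd : Nondeg D)
    (hA : A = D * C) (hB : B = C * D) :
    (∃ (p : ℕ) (A' B' : Matrix (Fin p) (Fin p) R),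
        RowSplitting A A' ∧ ColSplitting B B' ∧ ConjOver A' B') ∧
    (Nondeg A → Nondeg B → (∀ x y : R, x * y = 0 → x = 0 ∨ y = 0) →
      ∃ (p : ℕ) (A' B' : Matrix (Fin p) (Fin p) R),
        Nondeg A' ∧ Nondeg B' ∧
        RowSplitting A A' ∧ ColSplitting B B' ∧ ConjOver A' B') := by
  rcases subsingleton_or_nontrivial R with hR | hR
  · have : IsEmpty (Fin n) := ⟨fun i => (hDnd.1 i).elim fun j hj => hj (Subsingleton.elim _ _)⟩
    have hV : IsAmalgamation (1 : Matrix (Fin n) (Fin n) R) :=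
      ⟨isEmptyElim, isEmptyElim, isEmptyElim⟩
    have h : ∃ (p : ℕ) (A' B' : Matrix (Fin p) (Fin p) R), Nondeg A' ∧ Nondeg B' ∧
        RowSplitting A A' ∧ ColSplitting B B' ∧ ConjOver A' B' :=
      ⟨n, A, B, ⟨isEmptyElim, isEmptyElim⟩, ⟨isEmptyElim, isEmptyElim⟩,
        ⟨1, A, ⟨isEmptyElim, isEmptyElim, isEmptyElim⟩, by simp, by simp⟩,
        ⟨B, 1, hV, by simp, by simp⟩, 1, 1, by simp, by simp, Subsingleton.elim _ _⟩
    obtain ⟨p, A', B', hA', hB', h⟩ := h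
    exact ⟨⟨p, A', B', h⟩, fun _ _ _ => ⟨p, A', B', hA', hB', h⟩⟩
  obtain ⟨p, f, t, W, Winv, hf, ht, hD, hW, hW', hWV, hVW⟩ :=
    exists_fin_intertwiner D.diag
  rw [hDdiag.diagonal_diag] at hD
  set V := mapMatrix R f with hVdef
  have hV : IsAmalgamation V := isAmalgamation_mapMatrix hf
  have hrow : RowSplitting A (diagonal t * V * C * Vᵀ) := by
    refine ⟨Vᵀ, diagonal t * V * C, hV, ?_, rfl⟩
    rw [hA, ← hD]
    simp only [Matrix.mul_assoc]
  have hcol : ColSplitting B (V * (C * Vᵀ * diagonal t)) := by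
    refine ⟨C * Vᵀ * diagonal t, V, hV, ?_, rfl⟩
    rw [hB, ← hD]
    simp only [Matrix.mul_assoc]
  have hconj : ConjOver (diagonal t * V * C * Vᵀ) (V * (C * Vᵀ * diagonal t)) := by
    refine ⟨W, Winv, hW, hW', ?_⟩
    calc Winv * (diagonal t * V * C * Vᵀ) * W
        = Winv * (diagonal t * V) * C * (Vᵀ * W) := by simp only [Matrix.mul_assoc]
      _ = (Winv * W) * V * C * (Vᵀ * diagonal t) := by
        rw [← hWV, hVW]
        simp only [Matrix.mul_assoc]
      _ = V * (C * Vᵀ * diagonal t) := by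
        rw [hW', Matrix.one_mul]
        simp only [Matrix.mul_assoc]
  refine ⟨⟨p, _, _, hrow, hcol, hconj⟩, fun hAnd _ hR' => ?_⟩
  have hAC : ∀ i j, A i j ≠ 0 → C i j ≠ 0 := by
    intro i j h hC
    rw [hA, ← hDdiag.diagonal_diag, Matrix.diagonal_mul, hC, mul_zero] at h
    exact h rfl
  have hne : ∀ x y : R, x ≠ 0 → y ≠ 0 → x * y ≠ 0 := fun x y hx hy h =>
    (hR' x y h).elim hx hy
  have hA' : ∀ i j, (diagonal t * V * C * Vᵀ) i j = t i * C (f i) (f j) := by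
    intro i j
    rw [hVdef, mul_transpose_mapMatrix, Matrix.mul_assoc, mapMatrix_mul]
    simp
  have hB' : ∀ i j, (V * (C * Vᵀ * diagonal t)) i j = C (f i) (f j) * t j := by
    intro i j
    rw [hVdef, mapMatrix_mul, mul_transpose_mapMatrix]
    simp
  have hCrow : ∀ i, ∃ j, C (f i) (f j) ≠ 0 := fun i => by
    obtain ⟨k, hk⟩ := hAnd.1 (f i)
    obtain ⟨j, rfl⟩ := hf k
    exact ⟨j, hAC _ _ hk⟩
  have hCcol : ∀ j, ∃ i, C (f i) (f j) ≠ 0 := fun j => by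
    obtain ⟨k, hk⟩ := hAnd.2 (f j)
    obtain ⟨i, rfl⟩ := hf k
    exact ⟨i, hAC _ _ hk⟩
  refine ⟨p, _, _, ⟨fun i => ?_, fun j => ?_⟩, ⟨fun i => ?_, fun j => ?_⟩, hrow, hcol, hconj⟩
  · exact (hCrow i).imp fun j h => hA' i j ▸ hne _ _ (ht i) h
  · exact (hCcol j).imp fun i h => hA' i j ▸ hne _ _ (ht i) h
  · exact (hCrow i).imp fun j h => hB' i j ▸ hne _ _ h (ht j)
  · exact (hCcol j).imp fun i h => hB' i j ▸ hne _ _ h (ht j)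
end

section
/- Let U be a nondiscrete unital subring of ℝ. Suppose A and B are square nonnegative matrices with entries in U, each of eventual rank one, which are strong shift equivalent over U. Then A and B are strong shift equivalent over U₊. -/
open Matrix

/-- All entries of a real matrix lie in the set `S`. -/
def entriesIn {m n : ℕ} (S : Set ℝ) (A : Matrix (Fin m) (Fin n) ℝ) : Prop :=
  ∀ i j, A i j ∈ S

/-- Elementary strong shift equivalence over `S` between square real matrices
(of possibly different sizes). -/
def ESSE (S : Set ℝ) (p q : (n : ℕ) × Matrix (Fin n) (Fin n) ℝ) : Prop :=
  ∃ (R : Matrix (Fin p.1) (Fin q.1) ℝ) (S' : Matrix (Fin q.1) (Fin p.1) ℝ),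
    entriesIn S R ∧ entriesIn S S' ∧ p.2 = R * S' ∧ q.2 = S' * R

/-- Strong shift equivalence over `S`: a finite chain of elementary strong shift
equivalences. -/
def SSE (S : Set ℝ) : ((n : ℕ) × Matrix (Fin n) (Fin n) ℝ) →
    ((n : ℕ) × Matrix (Fin n) (Fin n) ℝ) → Prop :=
  Relation.ReflTransGen (ESSE S)

/-- Strong shift equivalence over the nonnegative part of `U`, for square matrices indexed by
arbitrary types. -/
def PosSSE (U : Subring ℝ) {ι κ : Type} (P : Matrix ι ι ℝ) (Q : Matrix κ κ ℝ) : Prop :=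
  ∀ (m n : ℕ) (e : ι ≃ Fin m) (f : κ ≃ Fin n),
    SSE {x : ℝ | x ∈ U ∧ 0 ≤ x} ⟨m, P.submatrix e.symm e.symm⟩ ⟨n, Q.submatrix f.symm f.symm⟩

/-- All entries of a matrix lie in `U`. -/
def OverU (U : Subring ℝ) {m n : Type} (K : Matrix m n ℝ) : Prop := ∀ i j, K i j ∈ U

section Basic

variable {U : Subring ℝ} {ι κ μ l m n : Type}

theorem OverU.mul [Fintype n] {K : Matrix m n ℝ} {L : Matrix n l ℝ} (hK : OverU U K)
    (hL : OverU U L) : OverU U (K * L) := fun i j => by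
  rw [Matrix.mul_apply]
  exact sum_mem fun x _ => mul_mem (hK _ _) (hL _ _)

theorem OverU.add {K L : Matrix m n ℝ} (hK : OverU U K) (hL : OverU U L) : OverU U (K + L) :=
  fun i j => add_mem (hK i j) (hL i j)

theorem OverU.sub {K L : Matrix m n ℝ} (hK : OverU U K) (hL : OverU U L) : OverU U (K - L) :=
  fun i j => sub_mem (hK i j) (hL i j)

theorem OverU.neg {K : Matrix m n ℝ} (hK : OverU U K) : OverU U (-K) :=
  fun i j => neg_mem (hK i j)

theorem OverU.smul {K : Matrix m n ℝ} (hK : OverU U K) {a : ℝ} (ha : a ∈ U) : OverU U (a • K) :=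
  fun i j => mul_mem ha (hK i j)

theorem OverU.one [DecidableEq n] : OverU U (1 : Matrix n n ℝ) := fun i j => by
  rw [Matrix.one_apply]
  split_ifs
  exacts [one_mem _, zero_mem _]

theorem OverU.zero : OverU U (0 : Matrix m n ℝ) := fun _ _ => zero_mem _

theorem OverU.fromCols {K : Matrix m n ℝ} {L : Matrix m l ℝ} (hK : OverU U K) (hL : OverU U L) :
    OverU U (fromCols K L) := by
  rintro i (j | j)
  exacts [hK _ _, hL _ _]

theorem OverU.fromRows {K : Matrix n m ℝ} {L : Matrix l m ℝ} (hK : OverU U K) (hL : OverU U L) :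
    OverU U (fromRows K L) := by
  rintro (j | j) i
  exacts [hK _ _, hL _ _]

theorem OverU.submatrix {K : Matrix n m ℝ} (hK : OverU U K) (f : ι → n) (g : κ → m) :
    OverU U (K.submatrix f g) := fun _ _ => hK _ _

theorem ESSE.symm {S : Set ℝ} {p q : (n : ℕ) × Matrix (Fin n) (Fin n) ℝ} (h : ESSE S p q) :
    ESSE S q p := by
  obtain ⟨R, T, hR, hT, h1, h2⟩ := h
  exact ⟨T, R, hT, hR, h2, h1⟩

theorem SSE.symm {S : Set ℝ} {p q : (n : ℕ) × Matrix (Fin n) (Fin n) ℝ} (h : SSE S p q) :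
    SSE S q p := by
  induction h with
  | refl => exact .refl
  | tail _ h ih => exact .head h.symm ih

theorem PosSSE.symm {P : Matrix ι ι ℝ} {Q : Matrix κ κ ℝ} (h : PosSSE U P Q) : PosSSE U Q P :=
  fun m n e f => (h n m f e).symm

theorem PosSSE.trans [Fintype κ] {P : Matrix ι ι ℝ} {Q : Matrix κ κ ℝ} {T : Matrix μ μ ℝ}
    (h : PosSSE U P Q) (h' : PosSSE U Q T) : PosSSE U P T := fun m n e f =>
  (h m _ e (Fintype.equivFin κ)).trans (h' _ n (Fintype.equivFin κ) f)

theorem PosSSE.of_mul [Fintype ι] [Fintype κ] {R : Matrix ι κ ℝ} {T : Matrix κ ι ℝ}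
    (hR : OverU U R) (hT : OverU U T) (hR0 : ∀ i j, 0 ≤ R i j) (hT0 : ∀ i j, 0 ≤ T i j) :
    PosSSE U (R * T) (T * R) := fun _ _ e f =>
  Relation.ReflTransGen.single ⟨R.submatrix e.symm f.symm, T.submatrix f.symm e.symm,
    fun _ _ => ⟨hR _ _, hR0 _ _⟩, fun _ _ => ⟨hT _ _, hT0 _ _⟩,
    (Matrix.submatrix_mul_equiv R T e.symm f.symm e.symm).symm,
    (Matrix.submatrix_mul_equiv T R f.symm e.symm f.symm).symm⟩

theorem PosSSE.of_eq_mul [Fintype ι] [Fintype κ] {P : Matrix ι ι ℝ} {Q : Matrix κ κ ℝ}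
    (R : Matrix ι κ ℝ) (T : Matrix κ ι ℝ) (hP : P = R * T) (hQ : Q = T * R)
    (hR : OverU U R) (hT : OverU U T) (hR0 : ∀ i j, 0 ≤ R i j) (hT0 : ∀ i j, 0 ≤ T i j) :
    PosSSE U P Q := by
  subst hP hQ
  exact .of_mul hR hT hR0 hT0

theorem PosSSE.refl [Fintype ι] [DecidableEq ι] {P : Matrix ι ι ℝ} (hP : OverU U P)
    (hP0 : ∀ i j, 0 ≤ P i j) : PosSSE U P P :=
  .of_eq_mul P 1 (by simp) (by simp) hP .one hP0 fun i j => by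
    rw [Matrix.one_apply]; split_ifs <;> norm_num

theorem PosSSE.sse {m n : ℕ} {P : Matrix (Fin m) (Fin m) ℝ} {Q : Matrix (Fin n) (Fin n) ℝ}
    (h : PosSSE U P Q) : SSE {x : ℝ | x ∈ U ∧ 0 ≤ x} ⟨m, P⟩ ⟨n, Q⟩ :=
  h m n (Equiv.refl _) (Equiv.refl _)

theorem exists_pos_lt_mem (hU : Dense (U : Set ℝ)) {a b : ℝ} (hab : a < b) :
    ∃ s ∈ U, a < s ∧ s < b := by
  obtain ⟨s, hs, h⟩ := hU.exists_between hab
  exact ⟨s, hs, h⟩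

theorem dense_overU (hU : Dense (U : Set ℝ)) : Dense {K : Matrix m n ℝ | OverU U K} := by
  have h1 : {r : n → ℝ | ∀ j, r j ∈ U} = Set.univ.pi fun _ => (U : Set ℝ) := by ext; simp
  have h2 : {K : Matrix m n ℝ | OverU U K} = Set.univ.pi fun _ => {r : n → ℝ | ∀ j, r j ∈ U} := by
    ext
    exact ⟨fun h i _ => h i, fun h i => h i trivial⟩
  rw [h2, h1]
  exact dense_pi _ fun _ _ => dense_pi _ fun _ _ => hU

end Basic

/-- An open subset of `ℝⁿ` closed under addition and positive scaling. -/
structure IsOpenCone {n : Type} (C : Set (n → ℝ)) : Prop where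
  isOpen : IsOpen C
  add_mem : ∀ x ∈ C, ∀ y ∈ C, x + y ∈ C
  smul_mem : ∀ a : ℝ, 0 < a → ∀ x ∈ C, a • x ∈ C

/-- Open cones of vectors and of functionals pairing positively. -/
structure IsConePair {n : Type} [Fintype n] (C D : Set (n → ℝ)) : Prop where
  left : IsOpenCone C
  right : IsOpenCone D
  pos : ∀ d ∈ D, ∀ c ∈ C, 0 < d ⬝ᵥ c

/-- The columns of `K` lie in `C`. -/
def ColsIn {n ι : Type} (C : Set (n → ℝ)) (K : Matrix n ι ℝ) : Prop := ∀ j, Kᵀ j ∈ C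

/-- The rows of `L` lie in `D`. -/
def RowsIn {n ι : Type} (D : Set (n → ℝ)) (L : Matrix ι n ℝ) : Prop := ∀ i, L i ∈ D

section Cones

variable {U : Subring ℝ} {ι κ n : Type} {C C' D D' : Set (n → ℝ)}

theorem IsOpenCone.inter (h : IsOpenCone C) (h' : IsOpenCone C') : IsOpenCone (C ∩ C') where
  isOpen := h.isOpen.inter h'.isOpen
  add_mem x hx y hy := ⟨h.add_mem x hx.1 y hy.1, h'.add_mem x hx.2 y hy.2⟩
  smul_mem a ha x hx := ⟨h.smul_mem a ha x hx.1, h'.smul_mem a ha x hx.2⟩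

theorem IsConePair.inter [Fintype n] (h : IsConePair C D) (h' : IsConePair C' D') :
    IsConePair (C ∩ C') (D ∩ D') where
  left := h.left.inter h'.left
  right := h.right.inter h'.right
  pos d hd c hc := h.pos d hd.1 c hc.1

theorem ColsIn.inter {K : Matrix n ι ℝ} (h : ColsIn C K) (h' : ColsIn C' K) : ColsIn (C ∩ C') K :=
  fun j => ⟨h j, h' j⟩

theorem RowsIn.inter {L : Matrix ι n ℝ} (h : RowsIn D L) (h' : RowsIn D' L) : RowsIn (D ∩ D') L :=
  fun j => ⟨h j, h' j⟩

theorem ColsIn.mono {K : Matrix n ι ℝ} (h : ColsIn C K) (hC : C ⊆ C') : ColsIn C' K :=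
  fun j => hC (h j)

theorem RowsIn.mono {L : Matrix ι n ℝ} (h : RowsIn D L) (hD : D ⊆ D') : RowsIn D' L :=
  fun j => hD (h j)

theorem ColsIn.fromCols {K : Matrix n ι ℝ} {K' : Matrix n κ ℝ} (h : ColsIn C K)
    (h' : ColsIn C K') : ColsIn C (fromCols K K') := by
  rintro (j | j)
  exacts [h j, h' j]

theorem RowsIn.fromRows {L : Matrix ι n ℝ} {L' : Matrix κ n ℝ} (h : RowsIn D L)
    (h' : RowsIn D L') : RowsIn D (fromRows L L') := by
  rintro (j | j)
  exacts [h j, h' j]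

theorem IsOpenCone.sum_mem (h : IsOpenCone C) [Fintype ι] [Nonempty ι] {f : ι → n → ℝ}
    (hf : ∀ i, f i ∈ C) : ∑ i, f i ∈ C :=
  Finset.sum_induction_nonempty f (· ∈ C) (fun x y hx hy => h.add_mem x hx y hy)
    Finset.univ_nonempty fun i _ => hf i

theorem ColsIn.mul_pos [Fintype ι] [Nonempty ι] (h : IsOpenCone C) {K : Matrix n ι ℝ}
    (hK : ColsIn C K) {X : Matrix ι κ ℝ} (hX : ∀ i j, 0 < X i j) : ColsIn C (K * X) := by
  intro j
  have : (K * X)ᵀ j = ∑ i, X i j • Kᵀ i := by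
    ext a
    simp [Matrix.mul_apply, mul_comm]
  rw [this]
  exact h.sum_mem fun i => h.smul_mem _ (hX i j) _ (hK i)

theorem RowsIn.mul_pos [Fintype ι] [Nonempty ι] (h : IsOpenCone D) {L : Matrix ι n ℝ}
    (hL : RowsIn D L) {X : Matrix κ ι ℝ} (hX : ∀ i j, 0 < X i j) : RowsIn D (X * L) := by
  have := ColsIn.mul_pos (K := Lᵀ) (X := Xᵀ) h hL fun i j => hX j i
  rw [← Matrix.transpose_mul] at this
  exact this

theorem ColsIn.smul (h : IsOpenCone C) {K : Matrix n ι ℝ} (hK : ColsIn C K) {a : ℝ} (ha : 0 < a) :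
    ColsIn C (a • K) := fun j => h.smul_mem a ha _ (hK j)

theorem IsConePair.mul_pos [Fintype n] (h : IsConePair C D) {K : Matrix n ι ℝ} {L : Matrix κ n ℝ}
    (hK : ColsIn C K) (hL : RowsIn D L) (i : κ) (j : ι) : 0 < (L * K) i j :=
  h.pos _ (hL i) _ (hK j)

theorem isOpen_colsIn [Finite ι] (hC : IsOpen C) : IsOpen {K : Matrix n ι ℝ | ColsIn C K} := by
  simp only [ColsIn, Set.ofPred_forall]
  refine isOpen_iInter_of_finite fun j => hC.preimage ?_
  fun_prop

theorem isOpen_rowsIn [Finite ι] (hD : IsOpen D) : IsOpen {L : Matrix ι n ℝ | RowsIn D L} := by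
  simp only [RowsIn, Set.ofPred_forall]
  refine isOpen_iInter_of_finite fun j => hD.preimage ?_
  fun_prop

theorem isOpen_forall_pos [Finite ι] [Finite κ] : IsOpen {X : Matrix ι κ ℝ | ∀ i j, 0 < X i j} := by
  simp only [Set.ofPred_forall]
  refine isOpen_iInter_of_finite fun i => isOpen_iInter_of_finite fun j => ?_
  exact isOpen_lt continuous_const (by fun_prop)

/-- Finite families of vectors and functionals pairing positively are contained in a pair of open
cones pairing positively. -/
theorem exists_isConePair [Fintype n] [Fintype ι] [Fintype κ] [DecidableEq κ] {K : Matrix n ι ℝ}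
    {L : Matrix κ n ℝ} (h : ∀ i j, 0 < (L * K) i j) :
    ∃ C D, IsConePair C D ∧ ColsIn C K ∧ RowsIn D L := by
  obtain ⟨ε, hε, hεK⟩ : ∃ ε > 0, ∀ i j, ε * ‖Kᵀ j‖ < (L * K) i j := by
    have : ∀ᶠ ε in nhdsWithin (0 : ℝ) (Set.Ioi 0), ∀ i j, ε * ‖Kᵀ j‖ < (L * K) i j := by
      refine Filter.eventually_all.2 fun i => Filter.eventually_all.2 fun j => ?_
      refine nhdsWithin_le_nhds ?_
      refine (continuous_id.mul continuous_const).continuousAt.eventually_lt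
        continuousAt_const ?_
      simpa using h i j
    obtain ⟨ε, h1, h2⟩ := (this.and self_mem_nhdsWithin).exists
    exact ⟨ε, h2, h1⟩
  refine ⟨{x | ∀ i, ε * ‖x‖ < L i ⬝ᵥ x},
    {y | ∃ b : κ → ℝ, (∀ i, 0 ≤ b i) ∧ ∑ k, |y k - ∑ i, b i * L i k| < ε * ∑ i, b i},
    ⟨⟨?_, ?_, ?_⟩, ⟨?_, ?_, ?_⟩, ?_⟩, fun j i => hεK i j, fun i => ⟨Pi.single i 1, ?_, ?_⟩⟩
  · simp only [Set.ofPred_forall]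
    refine isOpen_iInter_of_finite fun i => isOpen_lt (by fun_prop) ?_
    exact Continuous.dotProduct continuous_const continuous_id
  · intro x hx y hy i
    rw [dotProduct_add]
    have := norm_add_le x y
    have h1 := hx i
    have h2 := hy i
    nlinarith
  · intro a ha x hx i
    rw [dotProduct_smul, norm_smul, Real.norm_of_nonneg ha.le, smul_eq_mul]
    have h1 := hx i
    nlinarith
  · simp only [Set.ofPred_exists, Set.ofPred_and]
    refine isOpen_iUnion fun b => ?_
    have : IsOpen {y : n → ℝ | ∑ k, |y k - ∑ i, b i * L i k| < ε * ∑ i, b i} :=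
      isOpen_lt (by fun_prop) continuous_const
    exact isOpen_const.inter this
  · rintro x ⟨b, hb, hx⟩ y ⟨c, hc, hy⟩
    refine ⟨b + c, fun i => add_nonneg (hb i) (hc i), ?_⟩
    simp only [Pi.add_apply, Finset.sum_add_distrib, add_mul, mul_add]
    refine lt_of_le_of_lt ?_ (add_lt_add hx hy)
    rw [← Finset.sum_add_distrib]
    refine Finset.sum_le_sum fun k _ => ?_
    refine le_trans (le_of_eq ?_) (abs_add_le _ _)
    congr 1
    ring
  · rintro a ha x ⟨b, hb, hx⟩
    refine ⟨a • b, fun i => mul_nonneg ha.le (hb i), ?_⟩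
    have h1 : ∀ k, |(a • x) k - ∑ i, (a • b) i * L i k| = a * |x k - ∑ i, b i * L i k| := fun k => by
      rw [← abs_of_pos ha, ← abs_mul, abs_of_pos ha, mul_sub, Finset.mul_sum]
      simp [mul_assoc]
    simp only [h1, ← Finset.mul_sum]
    simp only [Pi.smul_apply, smul_eq_mul, ← Finset.mul_sum]
    have := mul_lt_mul_of_pos_left hx ha
    linarith
  · rintro d ⟨b, hb, hd⟩ c hc
    have h1 : d ⬝ᵥ c = ∑ k, (d k - ∑ i, b i * L i k) * c k + ∑ i, b i * (L i ⬝ᵥ c) := by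
      simp only [dotProduct, sub_mul, Finset.sum_sub_distrib, Finset.mul_sum, Finset.sum_mul]
      rw [Finset.sum_comm (f := fun i k => b i * (L i k * c k))]
      simp [mul_assoc]
    have h2 : -(∑ k, |d k - ∑ i, b i * L i k|) * ‖c‖ ≤ ∑ k, (d k - ∑ i, b i * L i k) * c k := by
      rw [← Finset.sum_neg_distrib, Finset.sum_mul]
      refine Finset.sum_le_sum fun k _ => ?_
      have h3 := norm_le_pi_norm c k
      have h4 := neg_abs_le ((d k - ∑ i, b i * L i k) * c k)
      rw [abs_mul] at h4
      rw [Real.norm_eq_abs] at h3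
      have := mul_le_mul_of_nonneg_left h3 (abs_nonneg (d k - ∑ i, b i * L i k))
      linarith
    have h3 : ε * (∑ i, b i) * ‖c‖ ≤ ∑ i, b i * (L i ⬝ᵥ c) := by
      rw [Finset.mul_sum, Finset.sum_mul]
      refine Finset.sum_le_sum fun i _ => ?_
      have := mul_le_mul_of_nonneg_left (hc i).le (hb i)
      linarith
    have hsum : 0 < ∑ i, b i := by
      have : 0 < ε * ∑ i, b i := lt_of_le_of_lt (Finset.sum_nonneg fun _ _ => abs_nonneg _) hd
      exact (mul_pos_iff_of_pos_left hε).1 this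
    by_cases hc0 : ‖c‖ = 0
    · obtain ⟨i, -, hi⟩ : ∃ i ∈ Finset.univ, 0 < b i := by
        by_contra! hne
        exact absurd (Finset.sum_nonpos hne) (not_le.2 hsum)
      have := hc i
      rw [norm_eq_zero.1 hc0] at this
      simp at this
    · have hc0 : 0 < ‖c‖ := lt_of_le_of_ne (norm_nonneg _) (Ne.symm hc0)
      rw [h1]
      have := mul_lt_mul_of_pos_right hd hc0
      linarith
  · intro j
    by_cases hij : j = i <;> simp [hij]
  · simp [Pi.single_apply, hε]

end Cones

section EntrywiseOrder

variable {ι κ μ : Type}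

theorem mul_entry_nonneg [Fintype κ] {P : Matrix ι κ ℝ} {Q : Matrix κ μ ℝ}
    (hP : ∀ i j, 0 ≤ P i j) (hQ : ∀ i j, 0 ≤ Q i j) (i : ι) (j : μ) : 0 ≤ (P * Q) i j := by
  rw [Matrix.mul_apply]
  exact Finset.sum_nonneg fun k _ => mul_nonneg (hP i k) (hQ k j)

theorem mul_entry_pos [Fintype κ] [Nonempty κ] {P : Matrix ι κ ℝ} {Q : Matrix κ μ ℝ}
    (hP : ∀ i j, 0 < P i j) (hQ : ∀ i j, 0 < Q i j) (i : ι) (j : μ) : 0 < (P * Q) i j := by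
  rw [Matrix.mul_apply]
  exact Finset.sum_pos (fun k _ => mul_pos (hP i k) (hQ k j)) Finset.univ_nonempty

end EntrywiseOrder

section Factorization

variable {U : Subring ℝ} {J n : Type} {C : Set (n → ℝ)}

theorem exists_pos_mem_of_eventually (hU : Dense (U : Set ℝ)) {p : ℝ → Prop}
    (h : ∀ᶠ s in nhds 0, p s) : ∃ s ∈ U, 0 < s ∧ p s := by
  obtain ⟨ε, hε, h⟩ := Metric.eventually_nhds_iff.1 h
  obtain ⟨s, hs, h0, h1⟩ := exists_pos_lt_mem hU hε
  refine ⟨s, hs, h0, h ?_⟩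
  rwa [Real.dist_eq, sub_zero, abs_of_pos h0]

/-- Vectors in an open cone over `U` are positive combinations of vectors over `U` in the cone. -/
theorem IsOpenCone.exists_pos_factor (hU : Dense (U : Set ℝ)) (hC : IsOpenCone C) [Fintype J]
    [DecidableEq J] [Nonempty J] {z : Matrix n J ℝ} (hz : ColsIn C z) (hzU : OverU U z) :
    ∃ (E : Matrix n (Option J) ℝ) (α : Matrix (Option J) J ℝ), OverU U E ∧ ColsIn C E ∧
      OverU U α ∧ (∀ i j, 0 < α i j) ∧ z = E * α := by
  obtain ⟨w, hwC, hwU⟩ : ∃ w ∈ C, ∀ i, w i ∈ U := by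
    refine ⟨_, hC.sum_mem (f := fun j i => z i j) hz, fun i => ?_⟩
    rw [Finset.sum_apply]
    exact _root_.sum_mem fun j _ => hzU i j
  obtain ⟨s, hsU, hs0, hs⟩ : ∃ s ∈ U, 0 < s ∧ ∀ j, zᵀ j - s • w ∈ C := by
    refine exists_pos_mem_of_eventually hU (Filter.eventually_all.2 fun j => ?_)
    have : Continuous fun s : ℝ => zᵀ j - s • w := by fun_prop
    refine this.continuousAt.eventually_mem (hC.isOpen.mem_nhds ?_)
    simpa using hz j
  set v : n → ℝ := ∑ j, (zᵀ j - s • w) with hv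
  have hvU : ∀ i, v i ∈ U := fun i => by
    rw [hv, Finset.sum_apply]
    exact _root_.sum_mem fun j _ => sub_mem (hzU i j) (mul_mem hsU (hwU i))
  obtain ⟨t, htU, ht0, ht⟩ : ∃ t ∈ U, 0 < t ∧ w - t • v ∈ C := by
    refine exists_pos_mem_of_eventually hU ?_
    have : Continuous fun t : ℝ => w - t • v := by fun_prop
    refine this.continuousAt.eventually_mem (hC.isOpen.mem_nhds ?_)
    simpa using hwC
  refine ⟨Matrix.of fun i o => o.elim ((w - t • v) i) fun j => (zᵀ j - s • w) i,
    Matrix.of fun o j => o.elim s fun i => (1 : Matrix J J ℝ) i j + s * t, ?_, ?_, ?_, ?_, ?_⟩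
  · rintro i (_ | j)
    exacts [sub_mem (hwU i) (mul_mem htU (hvU i)), sub_mem (hzU i j) (mul_mem hsU (hwU i))]
  · rintro (_ | j)
    exacts [ht, hs j]
  · rintro (_ | i) j
    exacts [hsU, AddMemClass.add_mem (OverU.one i j) (mul_mem hsU htU)]
  · rintro (_ | i) j
    · exact hs0
    · have : 0 ≤ (1 : Matrix J J ℝ) i j := by rw [Matrix.one_apply]; split_ifs <;> norm_num
      exact add_pos_of_nonneg_of_pos this (mul_pos hs0 ht0)
  · ext i j
    rw [Matrix.mul_apply, Fintype.sum_option]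
    have h1 : v i = ∑ k, (z i k - s * w i) := by simp [hv]
    simp only [Matrix.of_apply, Option.elim, mul_add, Finset.sum_add_distrib, ← Finset.sum_mul,
      Pi.sub_apply, Pi.smul_apply, smul_eq_mul, Matrix.transpose_apply, ← h1, Matrix.one_apply,
      mul_ite, mul_one, mul_zero, Finset.sum_ite_eq', Finset.mem_univ, if_true]
    ring

/-- A nonempty open cone contains vectors over `U` spanning `Uⁿ`. -/
theorem IsOpenCone.exists_unimodular (hU : Dense (U : Set ℝ)) (hC : IsOpenCone C)
    (hne : C.Nonempty) [Fintype n] [DecidableEq n] :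
    ∃ (E : Matrix n (Option n) ℝ) (E' : Matrix (Option n) n ℝ), OverU U E ∧ OverU U E' ∧
      ColsIn C E ∧ E * E' = 1 := by
  obtain ⟨g, hgC, hgU⟩ : ∃ g ∈ C, ∀ i, g i ∈ U := by
    have : Dense (Set.univ.pi fun _ : n => (U : Set ℝ)) := dense_pi _ fun _ _ => hU
    obtain ⟨g, h1, h2⟩ := this.inter_open_nonempty C hC.isOpen hne
    exact ⟨g, h1, fun i => h2 i trivial⟩
  obtain ⟨T, hT0, hT⟩ : ∃ T : ℕ, 0 < T ∧ ∀ j, g + (T : ℝ)⁻¹ • Pi.single j 1 ∈ C := by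
    have : ∀ᶠ T : ℕ in Filter.atTop, ∀ j, g + (T : ℝ)⁻¹ • Pi.single j 1 ∈ C := by
      refine tendsto_inv_atTop_nhds_zero_nat.eventually
        (p := fun s : ℝ => ∀ j, g + s • Pi.single j 1 ∈ C) (Filter.eventually_all.2 fun j => ?_)
      have : Continuous fun s : ℝ => g + s • (Pi.single j 1 : n → ℝ) := by fun_prop
      refine this.continuousAt.eventually_mem (hC.isOpen.mem_nhds ?_)
      simpa using hgC
    obtain ⟨T, h1, h2⟩ := (this.and (Filter.eventually_gt_atTop 0)).exists
    exact ⟨T, h2, h1⟩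
  have hT0' : (0 : ℝ) < T := Nat.cast_pos.2 hT0
  refine ⟨Matrix.of fun i o => o.elim (T * g i) fun j => T * g i + (1 : Matrix n n ℝ) i j,
    Matrix.of fun o j => o.elim (-1) fun i => (1 : Matrix n n ℝ) i j, ?_, ?_, ?_, ?_⟩
  · rintro i (_ | j)
    exacts [mul_mem (natCast_mem U T) (hgU i),
      AddMemClass.add_mem (mul_mem (natCast_mem U T) (hgU i)) (OverU.one i j)]
  · rintro (_ | i) j
    exacts [neg_mem (one_mem U), OverU.one i j]
  · rintro (_ | j)
    · exact hC.smul_mem T hT0' g hgC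
    · convert hC.smul_mem T hT0' _ (hT j) using 1
      ext i
      simp [mul_add, hT0'.ne', Matrix.one_apply, Pi.single_apply]
  · ext i j
    rw [Matrix.mul_apply, Fintype.sum_option]
    simp [Matrix.one_apply]

theorem IsOpenCone.exists_unimodular_factor (hU : Dense (U : Set ℝ)) (hC : IsOpenCone C)
    [Fintype J] [DecidableEq J] [Nonempty J] [Fintype n] [DecidableEq n] {z : Matrix n J ℝ}
    (hz : ColsIn C z) (hzU : OverU U z) :
    ∃ (E : Matrix n (Option (J ⊕ Option n)) ℝ) (E' : Matrix (Option (J ⊕ Option n)) n ℝ)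
      (α : Matrix (Option (J ⊕ Option n)) J ℝ), OverU U E ∧ OverU U E' ∧ OverU U α ∧
      ColsIn C E ∧ (∀ i j, 0 < α i j) ∧ E * E' = 1 ∧ z = E * α := by
  obtain ⟨E₀, E₀', h1, h2, h3, h4⟩ :=
    hC.exists_unimodular hU ⟨_, hz (Classical.arbitrary J)⟩
  obtain ⟨E, α, hE, hEC, hα, hα0, h⟩ := hC.exists_pos_factor hU (hz.fromCols h3) (hzU.fromCols h1)
  refine ⟨E, α * fromRows 0 E₀', α.submatrix id Sum.inl, hE, hα.mul (.fromRows .zero h2),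
    hα.submatrix _ _, hEC, fun i j => hα0 _ _, ?_, ?_⟩
  · rw [← Matrix.mul_assoc, ← h, fromCols_mul_fromRows, h4, Matrix.mul_zero, zero_add]
  · have := congrArg (fun M => M.submatrix id Sum.inl) h
    exact this

theorem IsOpenCone.exists_unimodular_factor_rows (hU : Dense (U : Set ℝ)) (hC : IsOpenCone C)
    [Fintype J] [DecidableEq J] [Nonempty J] [Fintype n] [DecidableEq n] {z : Matrix J n ℝ}
    (hz : RowsIn C z) (hzU : OverU U z) :
    ∃ (F : Matrix (Option (J ⊕ Option n)) n ℝ) (F' : Matrix n (Option (J ⊕ Option n)) ℝ)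
      (β : Matrix J (Option (J ⊕ Option n)) ℝ), OverU U F ∧ OverU U F' ∧ OverU U β ∧
      RowsIn C F ∧ (∀ i j, 0 < β i j) ∧ F' * F = 1 ∧ z = β * F := by
  obtain ⟨E, E', α, h1, h2, h3, h4, h5, h6, h7⟩ :=
    hC.exists_unimodular_factor hU (z := zᵀ) hz fun i j => hzU j i
  refine ⟨Eᵀ, E'ᵀ, αᵀ, fun i j => h1 j i, fun i j => h2 j i, fun i j => h3 j i, h4,
    fun i j => h5 j i, ?_, ?_⟩
  · rw [← Matrix.transpose_mul, h6, Matrix.transpose_one]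
  · rw [← Matrix.transpose_mul, ← h7, Matrix.transpose_transpose]

end Factorization

section Uniqueness

variable {U : Subring ℝ} {ι κ n p q : Type}

theorem PosSSE.of_sandwich_eq (hU : Dense (U : Set ℝ)) [Fintype n] [DecidableEq n] [Fintype p]
    [Fintype q] {E : Matrix n p ℝ} {E' : Matrix p n ℝ} {F : Matrix q n ℝ}
    {X X' : Matrix p q ℝ} (hE : OverU U E) (hE' : OverU U E') (hF : OverU U F)
    (hEE' : E * E' = 1) (hFE : ∀ i j, 0 ≤ (F * E) i j)
    (hX : OverU U X) (hX' : OverU U X') (hX0 : ∀ i j, 0 < X i j) (hX'0 : ∀ i j, 0 < X' i j)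
    (h : E * X * F = E * X' * F) : PosSSE U (X * (F * E)) (X' * (F * E)) := by
  set Z := X' - X with hZ
  set W := Z - E' * (E * Z) with hW
  have hZU : OverU U Z := hX'.sub hX
  have hWU : OverU U W := hZU.sub (hE'.mul (hE.mul hZU))
  have hEW : E * W = 0 := by
    rw [hW, Matrix.mul_sub, ← Matrix.mul_assoc E E', hEE', Matrix.one_mul, sub_self]
  have hWF : W * F = Z * F := by
    have : E * Z * F = 0 := by rw [hZ, Matrix.mul_sub, Matrix.sub_mul, h, sub_self]
    rw [hW, Matrix.sub_mul, Matrix.mul_assoc E', this, Matrix.mul_zero, sub_zero]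
  have hbound : ∀ {Y : Matrix p q ℝ}, (∀ i j, 0 < Y i j) →
      ∀ᶠ d in nhds (0 : ℝ), ∀ i j, 0 ≤ Y i j + d * W i j := fun {Y} hY => by
    refine Filter.eventually_all.2 fun i => Filter.eventually_all.2 fun j => ?_
    have hc : Continuous fun d : ℝ => Y i j + d * W i j := by fun_prop
    have := continuousAt_const.eventually_lt (hc.continuousAt (x := 0)) (by simpa using hY i j)
    exact this.mono fun _ => le_of_lt
  obtain ⟨δ, hδU, hδ0, hδ, hδ'⟩ := exists_pos_mem_of_eventually hU ((hbound hX0).and (hbound hX'0))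
  have key : ∀ t ∈ U, ∀ t' ∈ U, 0 ≤ t → t ≤ t' → t' ≤ 1 → t' - t ≤ δ →
      PosSSE U ((X + t • Z) * (F * E)) ((X + t' • Z) * (F * E)) := by
    intro t ht t' ht' h0 htt' h1 hd
    have e1 : F * E * (X + t • Z) = F * E * (X + t • Z + (t' - t) • W) := by
      rw [Matrix.mul_add (F * E) (X + t • Z), Matrix.mul_smul, Matrix.mul_assoc F E W, hEW,
        Matrix.mul_zero, smul_zero, add_zero]
    have e2 : (X + t' • Z) * (F * E) = (X + t • Z + (t' - t) • W) * (F * E) := by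
      rw [← Matrix.mul_assoc, ← Matrix.mul_assoc, Matrix.add_mul (X + t • Z), Matrix.smul_mul, hWF,
        ← Matrix.smul_mul, ← Matrix.add_mul, add_assoc, ← add_smul, add_sub_cancel]
    refine PosSSE.trans (κ := q) (.of_eq_mul _ _ rfl e1.symm (hX.add (hZU.smul ht)) (hF.mul hE) ?_ hFE)
      (.of_eq_mul _ _ rfl e2 (hF.mul hE)
        ((hX.add (hZU.smul ht)).add (hWU.smul (sub_mem ht' ht))) hFE ?_)
    · intro i j
      have := (hX0 i j).le
      have := (hX'0 i j).le
      simp only [hZ, Matrix.add_apply, Matrix.smul_apply, Matrix.sub_apply, smul_eq_mul]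
      nlinarith
    · intro i j
      obtain ⟨r, hr0, hr1, hr⟩ : ∃ r, 0 ≤ r ∧ r ≤ 1 ∧ t' - t = r * δ :=
        ⟨(t' - t) / δ, div_nonneg (by linarith) hδ0.le, (div_le_one hδ0).2 hd, by field_simp⟩
      have b1 : 0 ≤ X i j + r * (δ * W i j) := by nlinarith [hδ i j, hX0 i j]
      have b2 : 0 ≤ X' i j + r * (δ * W i j) := by nlinarith [hδ' i j, hX'0 i j]
      simp only [hr, Matrix.add_apply, Matrix.smul_apply, smul_eq_mul]
      rw [hZ, Matrix.sub_apply]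
      nlinarith
  have hmul : ∀ k : ℕ, k * δ ≤ 1 →
      PosSSE U ((X + (0 : ℝ) • Z) * (F * E)) ((X + (k * δ) • Z) * (F * E)) := by
    intro k
    induction k with
    | zero =>
      intro _
      simpa using key 0 (zero_mem _) 0 (zero_mem _) le_rfl le_rfl zero_le_one (by simpa using hδ0.le)
    | succ k ih =>
      intro hk
      push_cast at hk ⊢
      refine (ih (by linarith)).trans (key _ (mul_mem (natCast_mem U k) hδU) _
        (mul_mem (add_mem (natCast_mem U k) (one_mem U)) hδU) (by positivity) (by linarith) hk
        (by linarith))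
  have hfl := Nat.floor_le (one_div_pos.2 hδ0).le
  have hfl' := Nat.lt_floor_add_one (1 / δ)
  rw [le_div_iff₀ hδ0] at hfl
  rw [div_lt_iff₀ hδ0] at hfl'
  have := (hmul ⌊1 / δ⌋₊ hfl).trans (key _ (mul_mem (natCast_mem U _) hδU) 1 (one_mem U)
    (by positivity) hfl le_rfl (by linarith))
  simpa [hZ] using this

/-- Two factorizations over `U` of the same matrix, adapted to the same pair of cones, give strong
shift equivalent positive matrices. -/
theorem IsConePair.posSSE (hU : Dense (U : Set ℝ)) [Fintype n] [DecidableEq n] [Fintype ι]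
    [DecidableEq ι] [Nonempty ι] [Fintype κ] [DecidableEq κ] [Nonempty κ] {C D : Set (n → ℝ)}
    (h : IsConePair C D) {K : Matrix n ι ℝ} {L : Matrix ι n ℝ} {K' : Matrix n κ ℝ}
    {L' : Matrix κ n ℝ} (hK : OverU U K) (hL : OverU U L) (hK' : OverU U K') (hL' : OverU U L')
    (hKC : ColsIn C K) (hLD : RowsIn D L) (hKC' : ColsIn C K') (hLD' : RowsIn D L')
    (heq : K * L = K' * L') : PosSSE U (L * K) (L' * K') := by
  obtain ⟨E, E', α, hE, hE', hα, hEC, hα0, hEE', hz⟩ :=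
    h.left.exists_unimodular_factor hU (hKC.fromCols hKC') (hK.fromCols hK')
  obtain ⟨F, F', β, hF, hF', hβ, hFD, hβ0, hFF', hy⟩ :=
    h.right.exists_unimodular_factor_rows hU (hLD.fromRows hLD') (hL.fromRows hL')
  have hFE := h.mul_pos hEC hFD
  have main : ∀ {μ : Type} [Fintype μ] [Nonempty μ] (f : μ → ι ⊕ κ),
      PosSSE U (β.submatrix f id * (F * E) * α.submatrix id f)
        (α.submatrix id f * β.submatrix f id * (F * E)) := fun f => by
    rw [Matrix.mul_assoc (α.submatrix id f)]
    exact .of_mul ((hβ.submatrix _ _).mul (hF.mul hE)) (hα.submatrix _ _)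
      (mul_entry_nonneg (fun _ _ => (hβ0 _ _).le) fun _ _ => (hFE _ _).le)
      fun _ _ => (hα0 _ _).le
  have hK1 : K = E * α.submatrix id Sum.inl := congrArg (fun M => M.submatrix id Sum.inl) hz
  have hK2 : K' = E * α.submatrix id Sum.inr := congrArg (fun M => M.submatrix id Sum.inr) hz
  have hL1 : L = β.submatrix Sum.inl id * F := congrArg (fun M => M.submatrix Sum.inl id) hy
  have hL2 : L' = β.submatrix Sum.inr id * F := congrArg (fun M => M.submatrix Sum.inr id) hy
  have e1 : L * K = β.submatrix Sum.inl id * (F * E) * α.submatrix id Sum.inl := by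
    rw [hK1, hL1]; simp only [Matrix.mul_assoc]
  have e2 : L' * K' = β.submatrix Sum.inr id * (F * E) * α.submatrix id Sum.inr := by
    rw [hK2, hL2]; simp only [Matrix.mul_assoc]
  rw [e1, e2]
  refine (main Sum.inl).trans (PosSSE.trans ?_ (main Sum.inr).symm)
  refine .of_sandwich_eq hU hE hE' hF hEE' (fun i j => (hFE i j).le)
    ((hα.submatrix _ _).mul (hβ.submatrix _ _)) ((hα.submatrix _ _).mul (hβ.submatrix _ _))
    (mul_entry_pos (fun _ _ => hα0 _ _) fun _ _ => hβ0 _ _)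
    (mul_entry_pos (fun _ _ => hα0 _ _) fun _ _ => hβ0 _ _) ?_
  rw [← Matrix.mul_assoc, ← hK1, ← Matrix.mul_assoc, ← hK2, Matrix.mul_assoc, Matrix.mul_assoc,
    ← hL1, ← hL2, heq]

end Uniqueness

section Existence

variable {U : Subring ℝ} {ι p q n : Type} {C D : Set (n → ℝ)}

theorem IsConePair.exists_strict_decomposition [Fintype n] [Fintype ι] [Nonempty ι]
    [Fintype p] [Nonempty p] [Fintype q] [Nonempty q] (h : IsConePair C D) {K : Matrix n ι ℝ}
    {L : Matrix ι n ℝ} (hK : ColsIn C K) (hL : RowsIn D L) {E : Matrix n p ℝ} {F : Matrix q n ℝ}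
    (hE : ColsIn C E) (hF : RowsIn D F) :
    ∃ (K' : Matrix n (ι ⊕ (ι ⊕ ι)) ℝ) (L' : Matrix (ι ⊕ (ι ⊕ ι)) n ℝ) (c : ℝ), ColsIn C K' ∧
      RowsIn D L' ∧ 0 < c ∧ K' * L' + E * (Matrix.of fun _ _ => c : Matrix p q ℝ) * F = K * L := by
  set O : Matrix p ι ℝ := Matrix.of fun _ _ => 1 with hO
  set O' : Matrix ι q ℝ := Matrix.of fun _ _ => 1 with hO'
  have hc : ∀ᶠ ε in nhdsWithin (0 : ℝ) (Set.Ioi 0),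
      ColsIn C (K - ε • (E * O)) ∧ RowsIn D (L - ε • (O' * F)) := by
    refine nhdsWithin_le_nhds (Filter.Eventually.and ?_ ?_)
    · have : Continuous fun ε : ℝ => K - ε • (E * O) := by fun_prop
      exact this.continuousAt.eventually_mem
        ((isOpen_colsIn h.left.isOpen).mem_nhds (by simpa using hK))
    · have : Continuous fun ε : ℝ => L - ε • (O' * F) := by fun_prop
      exact this.continuousAt.eventually_mem
        ((isOpen_rowsIn h.right.isOpen).mem_nhds (by simpa using hL))
  obtain ⟨ε, ⟨h1, h2⟩, hε⟩ := (hc.and self_mem_nhdsWithin).exists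
  have hε : 0 < ε := hε
  refine ⟨fromCols (K - ε • (E * O)) (fromCols (K - ε • (E * O)) (ε • (E * O))),
    fromRows (L - ε • (O' * F)) (fromRows (ε • (O' * F)) (L - ε • (O' * F))),
    ε * ε * Fintype.card ι, ?_, ?_, ?_, ?_⟩
  · exact h1.fromCols (h1.fromCols ((hE.mul_pos h.left fun _ _ => one_pos).smul h.left hε))
  · exact h2.fromRows (RowsIn.fromRows
      (fun i => h.right.smul_mem ε hε _ (hF.mul_pos h.right (fun _ _ => one_pos) i)) h2)
  · have := Fintype.card_pos (α := ι)
    positivity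
  · have e : (Matrix.of fun _ _ => ε * ε * (Fintype.card ι : ℝ) : Matrix p q ℝ)
        = ε • ε • (O * O') := by
      ext i j
      simp [hO, hO', Matrix.mul_apply, mul_assoc]
    rw [e, fromCols_mul_fromRows, fromCols_mul_fromRows]
    simp only [Matrix.sub_mul, Matrix.mul_sub, Matrix.mul_smul, Matrix.smul_mul, Matrix.mul_assoc]
    module

/-- Matrices over `U` close to a matrix with a real factorization adapted to a pair of cones have a
robust factorization over `U` adapted to the same cones. -/
theorem IsConePair.eventually_exists_decomposition (hU : Dense (U : Set ℝ)) [Fintype n]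
    [DecidableEq n] [Fintype ι] [Nonempty ι] (h : IsConePair C D) {K : Matrix n ι ℝ}
    {L : Matrix ι n ℝ} (hK : ColsIn C K) (hL : RowsIn D L) :
    ∀ᶠ M in nhds (K * L), OverU U M →
      ∃ (K' : Matrix n (ι ⊕ (ι ⊕ ι)) ℝ) (L' : Matrix (ι ⊕ (ι ⊕ ι)) n ℝ)
        (E : Matrix n (Option n) ℝ) (E' : Matrix (Option n) n ℝ)
        (F : Matrix (Option n) n ℝ) (F' : Matrix n (Option n) ℝ)
        (X : Matrix (Option n) (Option n) ℝ),
        OverU U K' ∧ OverU U L' ∧ ColsIn C K' ∧ RowsIn D L' ∧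
        OverU U E ∧ OverU U E' ∧ OverU U F ∧ OverU U F' ∧ OverU U X ∧ ColsIn C E ∧ RowsIn D F ∧
        (∀ i j, 0 < X i j) ∧ E * E' = 1 ∧ F' * F = 1 ∧ K' * L' + E * X * F = M := by
  obtain ⟨E, E', hE, hE', hEC, hEE'⟩ :=
    h.left.exists_unimodular hU ⟨_, hK (Classical.arbitrary ι)⟩
  obtain ⟨G, G', hG, hG', hGD, hGG'⟩ :=
    h.right.exists_unimodular hU ⟨_, hL (Classical.arbitrary ι)⟩
  obtain ⟨F, F', hF, hF', hFD, hFF'⟩ : ∃ (F : Matrix (Option n) n ℝ) (F' : Matrix n (Option n) ℝ),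
      OverU U F ∧ OverU U F' ∧ RowsIn D F ∧ F' * F = 1 :=
    ⟨Gᵀ, G'ᵀ, fun i j => hG j i, fun i j => hG' j i, hGD, by
      rw [← Matrix.transpose_mul, hGG', Matrix.transpose_one]⟩
  obtain ⟨K₀, L₀, c, hK₀, hL₀, hc, hKL⟩ := h.exists_strict_decomposition hK hL hEC hFD
  let Y : ℝ → Matrix (Option n) (Option n) ℝ := fun y => Matrix.of fun _ _ => y
  let X : Matrix n n ℝ →
      Matrix n (ι ⊕ (ι ⊕ ι)) ℝ × Matrix (ι ⊕ (ι ⊕ ι)) n ℝ × ℝ → Matrix (Option n) (Option n) ℝ :=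
    fun M w => Y w.2.2 + E' * (M - w.1 * w.2.1 - E * Y w.2.2 * F) * F'
  have hY : Continuous Y := continuous_matrix fun _ _ => continuous_id
  have hX₁ : ∀ M, Continuous (X M) := fun M => by
    have := hY.comp (f := fun w : Matrix n (ι ⊕ (ι ⊕ ι)) ℝ × Matrix (ι ⊕ (ι ⊕ ι)) n ℝ × ℝ => w.2.2)
      (by fun_prop)
    simp only [Function.comp_def] at this
    fun_prop
  have hX₂ : ∀ w, Continuous fun M => X M w := fun w => by fun_prop
  have hopen : IsOpen {w | ColsIn C w.1 ∧ RowsIn D w.2.1 ∧ ∀ i j, 0 < X (K * L) w i j} :=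
    ((isOpen_colsIn h.left.isOpen).preimage continuous_fst).inter
      (((isOpen_rowsIn h.right.isOpen).preimage (continuous_fst.comp continuous_snd)).inter
        (isOpen_forall_pos.preimage (hX₁ _)))
  have hne : (K₀, L₀, c) ∈ {w | ColsIn C w.1 ∧ RowsIn D w.2.1 ∧ ∀ i j, 0 < X (K * L) w i j} := by
    refine ⟨hK₀, hL₀, fun i j => ?_⟩
    have : X (K * L) (K₀, L₀, c) = Y c := by
      simp only [X]
      rw [← hKL, add_sub_cancel_left, sub_self, Matrix.mul_zero, Matrix.zero_mul, add_zero]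
    rw [this]
    exact hc
  obtain ⟨⟨K', L', y⟩, ⟨hK'C, hL'D, hX0⟩, hK', hL', hy⟩ :=
    ((dense_overU hU).prod ((dense_overU hU).prod hU)).inter_open_nonempty _ hopen ⟨_, hne⟩
  have hev : ∀ᶠ M in nhds (K * L), ∀ i j, 0 < X M (K', L', y) i j :=
    (hX₂ _).continuousAt.eventually_mem (isOpen_forall_pos.mem_nhds hX0)
  refine hev.mono fun M hM hMU => ⟨K', L', E, E', F, F', X M (K', L', y), hK', hL', hK'C, hL'D, hE,
    hE', hF, hF', ?_, hEC, hFD, hM, hEE', hFF', ?_⟩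
  · have hYU : OverU U (Y y) := fun _ _ => hy
    exact hYU.add ((hE'.mul ((hMU.sub (OverU.mul hK' hL')).sub ((hE.mul hYU).mul hF))).mul hF')
  · have : E * X M (K', L', y) * F = E * Y y * F + (M - K' * L' - E * Y y * F) := by
      simp only [X]
      rw [Matrix.mul_add, Matrix.add_mul]
      congr 1
      rw [Matrix.mul_assoc, Matrix.mul_assoc, hFF', Matrix.mul_one, ← Matrix.mul_assoc, hEE',
        Matrix.one_mul]
    rw [this]
    abel

theorem IsConePair.eventually_exists_left (hU : Dense (U : Set ℝ)) [Fintype n]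
    [DecidableEq n] [Fintype ι] [Nonempty ι] (h : IsConePair C D) {K : Matrix n ι ℝ}
    {L : Matrix ι n ℝ} (hK : ColsIn C K) (hL : RowsIn D L) :
    ∀ᶠ M in nhds (K * L), OverU U M →
      ∃ (K' : Matrix n ((ι ⊕ (ι ⊕ ι)) ⊕ Option n) ℝ) (L' : Matrix ((ι ⊕ (ι ⊕ ι)) ⊕ Option n) n ℝ)
        (F' : Matrix n ((ι ⊕ (ι ⊕ ι)) ⊕ Option n) ℝ), OverU U K' ∧ OverU U L' ∧ OverU U F' ∧
        ColsIn C K' ∧ RowsIn D L' ∧ K' * L' = M ∧ F' * L' = 1 := by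
  refine (h.eventually_exists_decomposition hU hK hL).mono fun M hM hMU => ?_
  obtain ⟨K', L', E, E', F, F', X, hK', hL', hK'C, hL'D, hE, hE', hF, hF', hX, hEC, hFD, hX0,
    hEE', hFF', rfl⟩ := hM hMU
  refine ⟨fromCols K' (E * X), fromRows L' F, fromCols 0 F', hK'.fromCols (hE.mul hX),
    hL'.fromRows hF, OverU.zero.fromCols hF', hK'C.fromCols (hEC.mul_pos h.left hX0),
    hL'D.fromRows hFD, ?_, ?_⟩
  · rw [fromCols_mul_fromRows]
  · rw [fromCols_mul_fromRows, hFF', Matrix.zero_mul, zero_add]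

theorem IsConePair.eventually_exists_right (hU : Dense (U : Set ℝ)) [Fintype n]
    [DecidableEq n] [Fintype ι] [Nonempty ι] (h : IsConePair C D) {K : Matrix n ι ℝ}
    {L : Matrix ι n ℝ} (hK : ColsIn C K) (hL : RowsIn D L) :
    ∀ᶠ M in nhds (K * L), OverU U M →
      ∃ (K' : Matrix n ((ι ⊕ (ι ⊕ ι)) ⊕ Option n) ℝ) (L' : Matrix ((ι ⊕ (ι ⊕ ι)) ⊕ Option n) n ℝ)
        (E' : Matrix ((ι ⊕ (ι ⊕ ι)) ⊕ Option n) n ℝ), OverU U K' ∧ OverU U L' ∧ OverU U E' ∧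
        ColsIn C K' ∧ RowsIn D L' ∧ K' * L' = M ∧ K' * E' = 1 := by
  refine (h.eventually_exists_decomposition hU hK hL).mono fun M hM hMU => ?_
  obtain ⟨K', L', E, E', F, F', X, hK', hL', hK'C, hL'D, hE, hE', hF, hF', hX, hEC, hFD, hX0,
    hEE', hFF', rfl⟩ := hM hMU
  refine ⟨fromCols K' E, fromRows L' (X * F), fromRows 0 E', hK'.fromCols hE,
    hL'.fromRows (hX.mul hF), OverU.zero.fromRows hE', hK'C.fromCols hEC,
    hL'D.fromRows (hFD.mul_pos h.right hX0), ?_, ?_⟩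
  · rw [fromCols_mul_fromRows, Matrix.mul_assoc]
  · rw [fromCols_mul_fromRows, hEE', Matrix.mul_zero, zero_add]

end Existence

/-- The spectral decomposition of a matrix whose only nonzero eigenvalue is `r > 0`, with
multiplicity one: `u` and `v` are right and left eigenvectors, and `N` is the nilpotent part. -/
structure IsSpectral {n : Type} [Fintype n] [DecidableEq n] (M : Matrix n n ℝ) (r : ℝ)
    (u : Matrix n Unit ℝ) (v : Matrix Unit n ℝ) (N : Matrix n n ℝ) : Prop where
  pos : 0 < r
  vu : v * u = 1
  Nu : N * u = 0
  vN : v * N = 0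
  nilpotent : IsNilpotent N
  eq : M = r • (u * v) + N

/-- A one-parameter group rescaling the nilpotent matrix `N` and fixing `u` and `v`. -/
structure IsGrading {n : Type} [Fintype n] [DecidableEq n] (u : Matrix n Unit ℝ)
    (v : Matrix Unit n ℝ) (N : Matrix n n ℝ) (G : ℝ → Matrix n n ℝ) : Prop where
  continuous : Continuous G
  zero : G 0 = 1
  mul_neg : ∀ t, G t * G (-t) = 1
  mul_N : ∀ t, G t * N = Real.exp t • (N * G t)
  mul_u : ∀ t, G t * u = u
  v_mul : ∀ t, v * G t = v

/-- Eventual rank one, with positive nonzero eigenvalue. -/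
def EventualRankOne {n : Type} [Fintype n] [DecidableEq n] (M : Matrix n n ℝ) : Prop :=
  (∃ k : ℕ, ∀ j ≥ k, (M ^ j).rank = 1) ∧ 0 < M.trace

section Spectral

variable {n : Type} [Fintype n] [DecidableEq n] {M N : Matrix n n ℝ} {r : ℝ}
  {u : Matrix n Unit ℝ} {v : Matrix Unit n ℝ} {G : ℝ → Matrix n n ℝ}

theorem exists_eq_mul_of_rank_eq_one (h : M.rank = 1) :
    ∃ (x : Matrix n Unit ℝ) (y : Matrix Unit n ℝ), M = x * y := by
  obtain ⟨⟨x, hx⟩, -, hspan⟩ := finrank_eq_one_iff'.1 h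
  choose c hc using fun j => hspan ⟨M.mulVecLin (Pi.single j 1), LinearMap.mem_range_self _ _⟩
  refine ⟨Matrix.of fun i _ => x i, Matrix.of fun _ j => c j, ?_⟩
  ext i j
  have := congrFun (congrArg Subtype.val (hc j)) i
  simp at this
  simp [Matrix.mul_apply, ← this, mul_comm]

omit [DecidableEq n] in
theorem trace_mul_unit (x : Matrix n Unit ℝ) (y : Matrix Unit n ℝ) :
    (x * y).trace = (y * x) () () := by
  rw [Matrix.trace_mul_comm]
  simp [Matrix.trace]

theorem matrix_unit_eq_smul (A : Matrix Unit Unit ℝ) : A = A () () • (1 : Matrix Unit Unit ℝ) := by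
  ext
  simp

theorem exists_spectral_decomposition (h : ∃ k : ℕ, ∀ j ≥ k, (M ^ j).rank = 1) :
    ∃ (u : Matrix n Unit ℝ) (v : Matrix Unit n ℝ) (N : Matrix n n ℝ), M.trace ≠ 0 ∧ v * u = 1 ∧
      N * u = 0 ∧ v * N = 0 ∧ IsNilpotent N ∧ M = M.trace • (u * v) + N := by
  obtain ⟨k₀, hk₀⟩ := h
  obtain ⟨k, hk, hk1⟩ : ∃ k, k₀ ≤ k ∧ k ≠ 0 := ⟨k₀ + 1, by omega, by omega⟩
  obtain ⟨x, y, hxy⟩ := exists_eq_mul_of_rank_eq_one (hk₀ k hk)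
  obtain ⟨s, hs⟩ : ∃ s : ℝ, y * x = s • 1 := ⟨_, matrix_unit_eq_smul _⟩
  have hs0 : s ≠ 0 := by
    rintro rfl
    have h2 := hk₀ (k + k) (by omega)
    rw [pow_add, hxy, Matrix.mul_assoc, ← Matrix.mul_assoc y, hs] at h2
    simp at h2
  set v := s⁻¹ • y with hv
  have hvx : v * x = 1 := by rw [hv, Matrix.smul_mul, hs, smul_smul, inv_mul_cancel₀ hs0, one_smul]
  have hP : M ^ k = s • (x * v) := by
    rw [hxy, hv, Matrix.mul_smul, smul_smul, mul_inv_cancel₀ hs0, one_smul]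
  have hcomm : M * (x * v) = x * v * M := by
    have h1 : M * M ^ k = M ^ k * M := (Commute.self_pow M k).eq
    rw [hP, Matrix.mul_smul, Matrix.smul_mul] at h1
    exact smul_right_injective _ hs0 h1
  have hidem : x * v * (x * v) = x * v := by
    rw [Matrix.mul_assoc, ← Matrix.mul_assoc v, hvx, Matrix.one_mul]
  obtain ⟨r, hr⟩ : ∃ r : ℝ, v * M * x = r • 1 := ⟨_, matrix_unit_eq_smul _⟩
  have hMx : M * x = r • x := by
    have : M * (x * v) * x = x * v * M * x := by rw [hcomm]
    rw [Matrix.mul_assoc, Matrix.mul_assoc x v x, hvx, Matrix.mul_one, Matrix.mul_assoc,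
      Matrix.mul_assoc, ← Matrix.mul_assoc v, hr, Matrix.mul_smul, Matrix.mul_one] at this
    exact this
  have hMxv : M * (x * v) = r • (x * v) := by rw [← Matrix.mul_assoc, hMx, Matrix.smul_mul]
  set Q : Matrix n n ℝ := 1 - x * v with hQ
  have hQ1 : M * Q = M - r • (x * v) := by rw [hQ, Matrix.mul_sub, Matrix.mul_one, hMxv]
  have hQM : Commute M Q := by
    rw [commute_iff_eq, hQ, Matrix.mul_sub, Matrix.sub_mul, hcomm, Matrix.mul_one, Matrix.one_mul]
  have hQQ : IsIdempotentElem Q := by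
    rw [IsIdempotentElem, hQ, Matrix.mul_sub, Matrix.sub_mul, Matrix.sub_mul, hidem]
    simp
  have hQx : Q * x = 0 := by
    rw [hQ, Matrix.sub_mul, Matrix.mul_assoc, hvx, Matrix.mul_one, Matrix.one_mul, sub_self]
  have hvQ : v * Q = 0 := by
    rw [hQ, Matrix.mul_sub, ← Matrix.mul_assoc, hvx, Matrix.mul_one, Matrix.one_mul, sub_self]
  have hnil : IsNilpotent (M * Q) := by
    refine ⟨k, ?_⟩
    rw [hQM.mul_pow, hQQ.pow_eq hk1, hP, Matrix.smul_mul, Matrix.mul_assoc, hvQ, Matrix.mul_zero,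
      smul_zero]
  have heq : M = r • (x * v) + M * Q := by rw [hQ1]; abel
  have htr : M.trace = r := by
    rw [heq, Matrix.trace_add, Matrix.trace_smul, trace_mul_unit, hvx,
      (Matrix.isNilpotent_trace_of_isNilpotent hnil).eq_zero]
    simp
  refine ⟨x, v, M * Q, ?_, hvx, ?_, ?_, hnil, htr.symm ▸ heq⟩
  · rw [htr]
    rintro rfl
    have h1 : M ^ k * x = 0 := by
      rw [← Nat.succ_pred hk1, pow_succ, Matrix.mul_assoc, hMx, zero_smul, Matrix.mul_zero]
    rw [hP, Matrix.smul_mul, Matrix.mul_assoc, hvx, Matrix.mul_one] at h1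
    have h2 := congrArg (v * ·) h1
    simp only [Matrix.mul_smul, hvx, Matrix.mul_zero] at h2
    have h3 := congrFun (congrFun h2 ()) ()
    simp [hs0] at h3
  · rw [Matrix.mul_assoc, hQx, Matrix.mul_zero]
  · rw [hQM.eq, ← Matrix.mul_assoc, hvQ, Matrix.zero_mul]

theorem EventualRankOne.exists_isSpectral (h : EventualRankOne M) :
    ∃ r u v N, IsSpectral M r u v N := by
  obtain ⟨u, v, N, -, hvu, hNu, hvN, hN, heq⟩ := exists_spectral_decomposition h.1
  exact ⟨M.trace, u, v, N, h.2, hvu, hNu, hvN, hN, heq⟩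

theorem EventualRankOne.of_nonneg (h : ∃ k : ℕ, ∀ j ≥ k, (M ^ j).rank = 1)
    (hM : ∀ i j, 0 ≤ M i j) : EventualRankOne M := by
  obtain ⟨-, -, -, htr, -⟩ := exists_spectral_decomposition h
  exact ⟨h, lt_of_le_of_ne (Finset.sum_nonneg fun i _ => hM i i) htr.symm⟩

theorem IsSpectral.mul_u (h : IsSpectral M r u v N) : M * u = r • u := by
  rw [h.eq, Matrix.add_mul, h.Nu, Matrix.smul_mul, Matrix.mul_assoc, h.vu, Matrix.mul_one, add_zero]

theorem IsSpectral.v_mul (h : IsSpectral M r u v N) : v * M = r • v := by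
  rw [h.eq, Matrix.mul_add, h.vN, Matrix.mul_smul, ← Matrix.mul_assoc, h.vu, Matrix.one_mul,
    add_zero]

theorem IsSpectral.exists_pow_eq (h : IsSpectral M r u v N) :
    ∃ k : ℕ, k ≠ 0 ∧ M ^ k = r ^ k • (u * v) := by
  have key : ∀ j : ℕ, M ^ (j + 1) = r ^ (j + 1) • (u * v) + N ^ (j + 1) := by
    intro j
    induction j with
    | zero => simpa using h.eq
    | succ j ih =>
      rw [pow_succ' M, ih, Matrix.mul_add, Matrix.mul_smul, ← Matrix.mul_assoc, h.mul_u,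
        Matrix.smul_mul, smul_smul, ← pow_succ, pow_succ' N (j + 1)]
      congr 1
      rw [h.eq, Matrix.add_mul, pow_succ' N j, Matrix.smul_mul, Matrix.mul_assoc u,
        ← Matrix.mul_assoc v, h.vN, Matrix.zero_mul, Matrix.mul_zero, smul_zero, zero_add]
  obtain ⟨k, hk⟩ := h.nilpotent
  refine ⟨k + 1, by omega, ?_⟩
  rw [key, pow_succ N, hk, Matrix.zero_mul, add_zero]

theorem exists_commutator_eq_of_isNilpotent (hN : IsNilpotent N) :
    ∃ H : Matrix n n ℝ, H * N - N * H = N := by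
  let T : Matrix n n ℝ →ₗ[ℝ] Matrix n n ℝ := LinearMap.mulRight ℝ N - LinearMap.mulLeft ℝ N
  by_contra hne
  have hN' : N ∉ LinearMap.range T := fun ⟨H, hH⟩ => hne ⟨H, hH⟩
  obtain ⟨φ, hφN, hφ⟩ := Submodule.exists_le_ker_of_notMem hN'
  set Y : Matrix n n ℝ := Matrix.of fun j i => φ (Matrix.single i j 1) with hY
  have hφY : ∀ A, φ A = (Y * A).trace := fun A => by
    conv_lhs => rw [Matrix.matrix_eq_sum_single A]
    simp only [map_sum, Matrix.trace, Matrix.diag, Matrix.mul_apply, hY, Matrix.of_apply]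
    rw [Finset.sum_comm]
    refine Finset.sum_congr rfl fun j _ => Finset.sum_congr rfl fun i _ => ?_
    have : Matrix.single i j (A i j) = A i j • Matrix.single i j (1 : ℝ) := by simp
    rw [this, map_smul, smul_eq_mul, mul_comm]
  have hcomm : N * Y = Y * N := by
    refine (Matrix.ext_iff_trace_mul_right).2 fun H => ?_
    have h1 : φ (H * N - N * H) = 0 := hφ (LinearMap.mem_range_self T H)
    rw [hφY, Matrix.mul_sub, Matrix.trace_sub, ← Matrix.mul_assoc, ← Matrix.mul_assoc,
      Matrix.trace_mul_comm, ← Matrix.mul_assoc, sub_eq_zero] at h1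
    exact h1
  refine hφN ?_
  rw [hφY]
  exact (Matrix.isNilpotent_trace_of_isNilpotent
    (Commute.isNilpotent_mul_left (show Commute Y N from hcomm.symm) hN)).eq_zero

theorem IsSpectral.exists_isGrading (h : IsSpectral M r u v N) : ∃ G, IsGrading u v N G := by
  let _ : NormedRing (Matrix n n ℝ) := Matrix.linftyOpNormedRing
  let _ : NormedAlgebra ℝ (Matrix n n ℝ) := Matrix.linftyOpNormedAlgebra
  let _ : NormedAlgebra ℚ (Matrix n n ℝ) := NormedAlgebra.restrictScalars ℚ ℝ _
  obtain ⟨H₀, hH₀⟩ := exists_commutator_eq_of_isNilpotent h.nilpotent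
  set Q : Matrix n n ℝ := 1 - u * v with hQ
  have hQu : Q * u = 0 := by
    rw [hQ, Matrix.sub_mul, Matrix.mul_assoc, h.vu, Matrix.mul_one, Matrix.one_mul, sub_self]
  have hvQ : v * Q = 0 := by
    rw [hQ, Matrix.mul_sub, ← Matrix.mul_assoc, h.vu, Matrix.mul_one, Matrix.one_mul, sub_self]
  have hQN : Q * N = N := by
    rw [hQ, Matrix.sub_mul, Matrix.mul_assoc, h.vN, Matrix.mul_zero, Matrix.one_mul, sub_zero]
  have hNQ : N * Q = N := by
    rw [hQ, Matrix.mul_sub, ← Matrix.mul_assoc, h.Nu, Matrix.zero_mul, Matrix.mul_one, sub_zero]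
  set H := Q * H₀ * Q with hH
  have hHN : N * (H + 1) = H * N := by
    have e : H * N - N * H = N := by
      calc H * N - N * H = Q * (H₀ * (Q * N)) - N * Q * H₀ * Q := by
            rw [hH]; simp only [Matrix.mul_assoc]
        _ = Q * (H₀ * (N * Q)) - Q * N * H₀ * Q := by rw [hQN, hNQ]
        _ = Q * (H₀ * N - N * H₀) * Q := by
            simp only [Matrix.mul_sub, Matrix.sub_mul, Matrix.mul_assoc]
        _ = N := by rw [hH₀, hQN, hNQ]
    rw [Matrix.mul_add, Matrix.mul_one]
    exact (sub_eq_iff_eq_add'.1 e).symm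
  have hHu : H * (u * v) = 0 := by
    rw [hH, Matrix.mul_assoc, ← Matrix.mul_assoc Q u, hQu, Matrix.zero_mul, Matrix.mul_zero]
  have hvH : u * v * H = 0 := by
    rw [hH, ← Matrix.mul_assoc, ← Matrix.mul_assoc, Matrix.mul_assoc u, hvQ, Matrix.mul_zero,
      Matrix.zero_mul, Matrix.zero_mul]
  have hGu : ∀ t : ℝ, NormedSpace.exp (t • H) * (u * v) = u * v := fun t => by
    have : SemiconjBy (u * v) 0 (t • H) := by
      rw [SemiconjBy, Matrix.mul_zero, Matrix.smul_mul, hHu, smul_zero]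
    have := this.exp_right
    rw [SemiconjBy, NormedSpace.exp_zero, Matrix.mul_one] at this
    exact this.symm
  have hvG : ∀ t : ℝ, u * v * NormedSpace.exp (t • H) = u * v := fun t => by
    have : SemiconjBy (u * v) (t • H) 0 := by
      rw [SemiconjBy, Matrix.zero_mul, Matrix.mul_smul, hvH, smul_zero]
    have := this.exp_right
    rw [SemiconjBy, NormedSpace.exp_zero, Matrix.one_mul] at this
    exact this
  refine ⟨fun t => NormedSpace.exp (t • H), ?_, ?_, fun t => ?_, fun t => ?_, fun t => ?_,
    fun t => ?_⟩
  · exact NormedSpace.exp_continuous.comp (by fun_prop)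
  · simp
  · rw [← Matrix.exp_add_of_commute _ _ ((Commute.refl H).smul_left t |>.smul_right (-t)),
      ← add_smul, add_neg_cancel, zero_smul, NormedSpace.exp_zero]
  · have h1 : SemiconjBy N (t • H + t • 1) (t • H) := by
      rw [SemiconjBy, ← smul_add, Matrix.mul_smul, hHN, Matrix.smul_mul]
    have h2 := h1.exp_right
    rw [SemiconjBy, NormedSpace.exp_add_of_commute
      ((Commute.one_right H).smul_left t |>.smul_right t)] at h2
    have h3 : NormedSpace.exp (t • (1 : Matrix n n ℝ)) = Real.exp t • 1 := by
      have := NormedSpace.algebraMap_exp_comm (𝕂 := ℝ) (𝔸 := Matrix n n ℝ) t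
      rw [Algebra.algebraMap_eq_smul_one, Algebra.algebraMap_eq_smul_one] at this
      exact this.symm.trans (by rw [Real.exp_eq_exp_ℝ])
    refine h2.symm.trans ((congrArg (fun Z => N * (NormedSpace.exp (t • H) * Z)) h3).trans ?_)
    simp only [Matrix.mul_smul, Matrix.mul_one]
  · have := congrArg (· * u) (hGu t)
    simp only [Matrix.mul_assoc, h.vu, Matrix.mul_one] at this
    exact this
  · have := congrArg (v * ·) (hvG t)
    simp only [← Matrix.mul_assoc, h.vu, Matrix.one_mul] at this
    exact this

end Spectral

/-- The real factorization `K`, `L` of `M` is adapted to a pair of cones to which a factorization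
over `U` is also adapted, and the latter represents the strong shift equivalence class of `Q`. -/
def RepClass (U : Subring ℝ) {n ι ω : Type} [Fintype n] (M : Matrix n n ℝ) (Q : Matrix ω ω ℝ)
    (K : Matrix n ι ℝ) (L : Matrix ι n ℝ) : Prop :=
  ∃ C D, IsConePair C D ∧ ColsIn C K ∧ RowsIn D L ∧
    ∃ (κ : Type) (_ : Fintype κ) (_ : DecidableEq κ) (_ : Nonempty κ) (K₁ : Matrix n κ ℝ)
      (L₁ : Matrix κ n ℝ), OverU U K₁ ∧ OverU U L₁ ∧ ColsIn C K₁ ∧ RowsIn D L₁ ∧ K₁ * L₁ = M ∧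
      PosSSE U (L₁ * K₁) Q

/-- A path of factorizations: the left factor. -/
noncomputable def pathK {n ι : Type} [Fintype n] [DecidableEq n] (r : ℝ) (u : Matrix n Unit ℝ)
    (v : Matrix Unit n ℝ) (G : ℝ → Matrix n n ℝ) (K : Matrix n ι ℝ) (t : ℝ) :
    Matrix n (ι ⊕ Unit) ℝ :=
  fromCols (Real.exp (-(3 * t)) • ((1 + (Real.exp t - 1) • (u * v)) * (G (3 * t) * K)))
    ((r * (1 - Real.exp (-t))) • u)

/-- A path of factorizations: the right factor. -/
noncomputable def pathL {n ι : Type} [Fintype n] [DecidableEq n] (u : Matrix n Unit ℝ)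
    (v : Matrix Unit n ℝ) (G : ℝ → Matrix n n ℝ) (L : Matrix ι n ℝ) (t : ℝ) :
    Matrix (ι ⊕ Unit) n ℝ :=
  fromRows (L * G (-(3 * t)) * (1 + (Real.exp t - 1) • (u * v))) v

section RepClass

variable {U : Subring ℝ} {ι κ n ω ω' : Type} [Fintype n] [DecidableEq n] {M : Matrix n n ℝ}
  {Q : Matrix ω ω ℝ} {Q' : Matrix ω' ω' ℝ} {C D : Set (n → ℝ)}

omit [DecidableEq n] in
theorem RepClass.of_factorization [Fintype ι] [DecidableEq ι] [Nonempty ι] {K : Matrix n ι ℝ}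
    {L : Matrix ι n ℝ} (hKU : OverU U K) (hLU : OverU U L) (h : IsConePair C D) (hK : ColsIn C K)
    (hL : RowsIn D L) (hM : K * L = M) : RepClass U M (L * K) K L :=
  ⟨C, D, h, hK, hL, ι, ‹_›, ‹_›, ‹_›, K, L, hKU, hLU, hK, hL, hM,
    .refl (hLU.mul hKU) fun i j => (h.mul_pos hK hL i j).le⟩

theorem RepClass.transfer (hU : Dense (U : Set ℝ)) (hM : OverU U M) [Fintype ι] [Nonempty ι]
    {K : Matrix n ι ℝ} {L : Matrix ι n ℝ} {K' : Matrix n κ ℝ} {L' : Matrix κ n ℝ}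
    (h : IsConePair C D) (hK : ColsIn C K) (hL : RowsIn D L) (hK' : ColsIn C K')
    (hL' : RowsIn D L') (hKL : K * L = M) (hQ : RepClass U M Q K L) : RepClass U M Q K' L' := by
  classical
  obtain ⟨C₁, D₁, h₁, hK₁, hL₁, κ, _, _, _, K₂, L₂, hK₂, hL₂, hK₂C, hL₂D, hM₂, hPQ⟩ := hQ
  subst hKL
  obtain ⟨K₃, L₃, -, hK₃, hL₃, -, hK₃C, hL₃D, hM₃, -⟩ :=
    ((h.inter h₁).eventually_exists_left hU (hK.inter hK₁) (hL.inter hL₁)).self_of_nhds hM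
  refine ⟨C, D, h, hK', hL', _, _, inferInstance, inferInstance, K₃, L₃, hK₃, hL₃,
    hK₃C.mono Set.inter_subset_left, hL₃D.mono Set.inter_subset_left, hM₃, ?_⟩
  exact (h₁.posSSE hU hK₃ hL₃ hK₂ hL₂ (hK₃C.mono Set.inter_subset_right)
    (hL₃D.mono Set.inter_subset_right) hK₂C hL₂D (hM₃.trans hM₂.symm)).trans hPQ

theorem RepClass.posSSE (hU : Dense (U : Set ℝ)) (hM : OverU U M) [Fintype ι] [Nonempty ι]
    {K : Matrix n ι ℝ} {L : Matrix ι n ℝ} (hKL : K * L = M) (hQ : RepClass U M Q K L)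
    (hQ' : RepClass U M Q' K L) : PosSSE U Q Q' := by
  classical
  obtain ⟨C, D, h, hK, hL, κ, _, _, _, K₂, L₂, hK₂, hL₂, hK₂C, hL₂D, hM₂, hPQ⟩ := hQ
  obtain ⟨C₁, D₁, h₁, hK₁, hL₁, κ', _, _, _, K₃, L₃, hK₃, hL₃, hK₃C, hL₃D, hM₃, hPQ'⟩ := hQ'
  subst hKL
  obtain ⟨K₄, L₄, -, hK₄, hL₄, -, hK₄C, hL₄D, hM₄, -⟩ :=
    ((h.inter h₁).eventually_exists_left hU (hK.inter hK₁) (hL.inter hL₁)).self_of_nhds hM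
  refine (hPQ.symm.trans (h.posSSE hU hK₂ hL₂ hK₄ hL₄ hK₂C hL₂D
    (hK₄C.mono Set.inter_subset_left) (hL₄D.mono Set.inter_subset_left)
    (hM₂.trans hM₄.symm))).trans ((h₁.posSSE hU hK₄ hL₄ hK₃ hL₃
    (hK₄C.mono Set.inter_subset_right) (hL₄D.mono Set.inter_subset_right) hK₃C hL₃D
    (hM₄.trans hM₃.symm)).trans hPQ')

end RepClass

section Path

variable {U : Subring ℝ} {ι κ n : Type} [Fintype n] [DecidableEq n] {M N : Matrix n n ℝ} {r : ℝ}
  {u : Matrix n Unit ℝ} {v : Matrix Unit n ℝ} {G : ℝ → Matrix n n ℝ}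

theorem IsGrading.neg_mul (hG : IsGrading u v N G) (t : ℝ) : G (-t) * G t = 1 := by
  simpa using hG.mul_neg (-t)

theorem pathK_mul_pathL [Fintype ι] (h : IsSpectral M r u v N) (hG : IsGrading u v N G)
    {K : Matrix n ι ℝ} {L : Matrix ι n ℝ} (hKL : K * L = M) (t : ℝ) :
    pathK r u v G K t * pathL u v G L t = M := by
  have hGM : G (3 * t) * M * G (-(3 * t)) = r • (u * v) + Real.exp (3 * t) • N := by
    rw [h.eq, Matrix.mul_add, Matrix.add_mul, hG.mul_N, Matrix.smul_mul, Matrix.mul_assoc N,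
      hG.mul_neg, Matrix.mul_one, Matrix.mul_smul, Matrix.smul_mul, ← Matrix.mul_assoc (G _) u,
      hG.mul_u, Matrix.mul_assoc, hG.v_mul]
  have hidem : u * v * (u * v) = u * v := by
    rw [Matrix.mul_assoc, ← Matrix.mul_assoc v, h.vu, Matrix.one_mul]
  have hNu : N * (u * v) = 0 := by rw [← Matrix.mul_assoc, h.Nu, Matrix.zero_mul]
  have hvN : u * v * N = 0 := by rw [Matrix.mul_assoc, h.vN, Matrix.mul_zero]
  have e1 : Real.exp (-(3 * t)) * Real.exp (3 * t) = 1 := by rw [← Real.exp_add]; simp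
  have e2 : Real.exp (-(3 * t)) * (Real.exp t * Real.exp t) = Real.exp (-t) := by
    rw [← Real.exp_add, ← Real.exp_add]; congr 1; ring
  calc pathK r u v G K t * pathL u v G L t
      = Real.exp (-(3 * t)) • ((1 + (Real.exp t - 1) • (u * v)) *
          (G (3 * t) * M * G (-(3 * t))) * (1 + (Real.exp t - 1) • (u * v)))
          + (r * (1 - Real.exp (-t))) • (u * v) := by
        rw [pathK, pathL, fromCols_mul_fromRows, ← hKL]
        simp only [Matrix.smul_mul, Matrix.mul_assoc]
    _ = (Real.exp (-(3 * t)) * (Real.exp t * Real.exp t) * r) • (u * v)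
          + (Real.exp (-(3 * t)) * Real.exp (3 * t)) • N
          + (r * (1 - Real.exp (-t))) • (u * v) := by
        rw [hGM]
        simp only [Matrix.add_mul, Matrix.mul_add, Matrix.one_mul, Matrix.mul_one, Matrix.smul_mul,
          Matrix.mul_smul, hidem, hNu, hvN, smul_zero, add_zero]
        module
    _ = M := by
        rw [e1, e2, h.eq]
        module

theorem pathL_mul_pathK (h : IsSpectral M r u v N) (hG : IsGrading u v N G)
    (K : Matrix n ι ℝ) (L : Matrix κ n ℝ) (t : ℝ) :
    pathL u v G L t * pathK r u v G K t = fromBlocks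
      (Real.exp (-(3 * t)) • (L * K + (Real.exp t * Real.exp t - 1) • (L * u * (v * K))))
      ((r * (1 - Real.exp (-t)) * Real.exp t) • (L * u))
      ((Real.exp (-(3 * t)) * Real.exp t) • (v * K)) ((r * (1 - Real.exp (-t))) • 1) := by
  have hidem : u * v * (u * v) = u * v := by
    rw [Matrix.mul_assoc, ← Matrix.mul_assoc v, h.vu, Matrix.one_mul]
  have e1 : (1 + (Real.exp t - 1) • (u * v)) * u = Real.exp t • u := by
    rw [Matrix.add_mul, Matrix.one_mul, Matrix.smul_mul, Matrix.mul_assoc, h.vu, Matrix.mul_one]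
    module
  have e2 : v * (1 + (Real.exp t - 1) • (u * v)) = Real.exp t • v := by
    rw [Matrix.mul_add, Matrix.mul_one, Matrix.mul_smul, ← Matrix.mul_assoc, h.vu, Matrix.one_mul]
    module
  have e3 : (1 + (Real.exp t - 1) • (u * v)) * (1 + (Real.exp t - 1) • (u * v))
      = 1 + (Real.exp t * Real.exp t - 1) • (u * v) := by
    simp only [Matrix.add_mul, Matrix.mul_add, Matrix.one_mul, Matrix.mul_one, Matrix.smul_mul,
      Matrix.mul_smul, hidem]
    module
  have e4 : G (-(3 * t)) * (u * v * G (3 * t)) = u * v := by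
    rw [Matrix.mul_assoc, hG.v_mul, ← Matrix.mul_assoc, hG.mul_u]
  rw [pathL, pathK, fromRows_mul_fromCols]
  congr 1
  · calc L * G (-(3 * t)) * (1 + (Real.exp t - 1) • (u * v)) *
          (Real.exp (-(3 * t)) • ((1 + (Real.exp t - 1) • (u * v)) * (G (3 * t) * K)))
        = Real.exp (-(3 * t)) • (L * (G (-(3 * t)) * (((1 + (Real.exp t - 1) • (u * v)) *
            (1 + (Real.exp t - 1) • (u * v))) * G (3 * t))) * K) := by
          simp only [Matrix.mul_smul, Matrix.mul_assoc]
      _ = Real.exp (-(3 * t)) • (L * (G (-(3 * t)) * G (3 * t)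
            + (Real.exp t * Real.exp t - 1) • (G (-(3 * t)) * (u * v * G (3 * t)))) * K) := by
          rw [e3, Matrix.add_mul, Matrix.one_mul, Matrix.mul_add, Matrix.smul_mul, Matrix.mul_smul]
      _ = _ := by
          rw [hG.neg_mul, e4, Matrix.mul_add, Matrix.mul_one, Matrix.add_mul, Matrix.mul_smul,
            Matrix.smul_mul]
          simp only [Matrix.mul_assoc]
  · rw [Matrix.mul_smul, Matrix.mul_assoc, e1, Matrix.mul_smul, Matrix.mul_assoc, hG.mul_u,
      smul_smul]
  · rw [Matrix.mul_smul, ← Matrix.mul_assoc, e2, Matrix.smul_mul, ← Matrix.mul_assoc, hG.v_mul,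
      smul_smul]
  · rw [Matrix.mul_smul, h.vu]

theorem pathL_mul_pathK_pos (h : IsSpectral M r u v N) (hG : IsGrading u v N G)
    {K : Matrix n ι ℝ} {L : Matrix κ n ℝ} (hu : ∀ i j, 0 < (L * u) i j)
    (hv : ∀ i j, 0 < (v * K) i j) {t : ℝ} (ht : 0 < t)
    (hLK : ∀ i j, 0 < (L * K) i j + (Real.exp t * Real.exp t - 1) * (L * u * (v * K)) i j)
    (i : κ ⊕ Unit) (j : ι ⊕ Unit) : 0 < (pathL u v G L t * pathK r u v G K t) i j := by
  have h1 : 0 < 1 - Real.exp (-t) := by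
    have : Real.exp (-t) < 1 := Real.exp_lt_one_iff.2 (by linarith)
    linarith
  have h2 := h.pos
  have h3 := Real.exp_pos t
  have h4 := Real.exp_pos (-(3 * t))
  rw [pathL_mul_pathK h hG]
  rcases i with i | i <;> rcases j with j | j
  · exact mul_pos h4 (hLK i j)
  · exact mul_pos (by positivity) (hu i j)
  · exact mul_pos (by positivity) (hv i j)
  · simpa using mul_pos h2 h1

theorem continuous_pathK (hG : IsGrading u v N G) (K : Matrix n ι ℝ) :
    Continuous (pathK r u v G K) := by
  have h1 := hG.continuous
  refine continuous_matrix fun i j => ?_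
  rcases j with j | j
  · have : Continuous fun t : ℝ =>
        Real.exp (-(3 * t)) • ((1 + (Real.exp t - 1) • (u * v)) * (G (3 * t) * K)) := by fun_prop
    exact this.matrix_elem i j
  · have : Continuous fun t : ℝ => (r * (1 - Real.exp (-t))) • u := by fun_prop
    exact this.matrix_elem i j

theorem continuous_pathL (hG : IsGrading u v N G) (L : Matrix ι n ℝ) :
    Continuous (pathL u v G L) := by
  have h1 := hG.continuous
  refine continuous_matrix fun i j => ?_
  rcases i with i | i
  · have : Continuous fun t : ℝ => L * G (-(3 * t)) * (1 + (Real.exp t - 1) • (u * v)) := by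
      fun_prop
    exact this.matrix_elem i j
  · exact continuous_const

theorem repClass_path (hU : Dense (U : Set ℝ)) (hM : OverU U M) (h : IsSpectral M r u v N)
    (hG : IsGrading u v N G) [Fintype ι] [DecidableEq ι] [Nonempty ι] {K : Matrix n ι ℝ}
    {L : Matrix ι n ℝ} (hK : OverU U K) (hL : OverU U L) (hKL : K * L = M)
    (hLK : ∀ i j, 0 < (L * K) i j) (hu : ∀ i j, 0 < (L * u) i j)
    (hv : ∀ i j, 0 < (v * K) i j) {t : ℝ} (ht : 0 < t) :
    RepClass U M (L * K) (pathK r u v G K t) (pathL u v G L t) := by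
  have hpos : ∀ t, 0 < t → ∀ i j, 0 < (pathL u v G L t * pathK r u v G K t) i j := fun t ht =>
    pathL_mul_pathK_pos h hG hu hv ht fun i j => by
      have h1 := Real.add_one_le_exp t
      have h2 := mul_entry_pos hu hv i j
      have h3 := hLK i j
      have h4 : 0 ≤ Real.exp t * Real.exp t - 1 := by nlinarith
      positivity
  obtain ⟨C, D, hCD, hKC, hLD⟩ := exists_isConePair hLK
  have hr := h.pos
  have huC : ColsIn C u := by
    have h1 : u = r⁻¹ • (K * (L * u)) := by
      rw [← Matrix.mul_assoc, hKL, h.mul_u, smul_smul, inv_mul_cancel₀ hr.ne', one_smul]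
    rw [h1]
    exact (hKC.mul_pos hCD.left hu).smul hCD.left (inv_pos.2 hr)
  have hvD : RowsIn D v := by
    have h1 : v = r⁻¹ • (v * K * L) := by
      rw [Matrix.mul_assoc, hKL, h.v_mul, smul_smul, inv_mul_cancel₀ hr.ne', one_smul]
    rw [h1]
    exact fun i => hCD.right.smul_mem _ (inv_pos.2 hr) _ (hLD.mul_pos hCD.right hv i)
  have hG1 := hG.continuous
  have hev : ∀ᶠ t in nhdsWithin (0 : ℝ) (Set.Ioi 0),
      ColsIn C (Real.exp (-(3 * t)) • ((1 + (Real.exp t - 1) • (u * v)) * (G (3 * t) * K))) ∧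
      RowsIn D (L * G (-(3 * t)) * (1 + (Real.exp t - 1) • (u * v))) := by
    refine nhdsWithin_le_nhds (Filter.Eventually.and ?_ ?_)
    · have : Continuous fun t : ℝ =>
        Real.exp (-(3 * t)) • ((1 + (Real.exp t - 1) • (u * v)) * (G (3 * t) * K)) := by fun_prop
      exact this.continuousAt.eventually_mem
        ((isOpen_colsIn hCD.left.isOpen).mem_nhds (by simpa [hG.zero] using hKC))
    · have : Continuous fun t : ℝ => L * G (-(3 * t)) * (1 + (Real.exp t - 1) • (u * v)) := by
        fun_prop
      exact this.continuousAt.eventually_mem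
        ((isOpen_rowsIn hCD.right.isOpen).mem_nhds (by simpa [hG.zero] using hLD))
  obtain ⟨s, ⟨hsK, hsL⟩, hs⟩ := (hev.and self_mem_nhdsWithin).exists
  have hs : 0 < s := hs
  have hs1 : 0 < r * (1 - Real.exp (-s)) := by
    have : Real.exp (-s) < 1 := Real.exp_lt_one_iff.2 (by linarith)
    exact mul_pos hr (by linarith)
  have hstart : RepClass U M (L * K) (pathK r u v G K s) (pathL u v G L s) :=
    (RepClass.of_factorization hK hL hCD hKC hLD hKL).transfer hU hM hCD hKC hLD
      (hsK.fromCols (huC.smul hCD.left hs1)) (hsL.fromRows hvD) hKL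
  have hiff : RepClass U M (L * K) (pathK r u v G K s) (pathL u v G L s) ↔
      RepClass U M (L * K) (pathK r u v G K t) (pathL u v G L t) := by
    refine isPreconnected_Ioi.induction₂ (s := Set.Ioi (0 : ℝ))
      (fun s t => RepClass U M (L * K) (pathK r u v G K s) (pathL u v G L s) ↔
        RepClass U M (L * K) (pathK r u v G K t) (pathL u v G L t)) ?_
      (fun _ _ _ _ _ _ => Iff.trans) (fun _ _ _ _ => Iff.symm) hs ht
    intro x hx
    obtain ⟨C, D, hCD, hKC, hLD⟩ := exists_isConePair (hpos x hx)
    have h1 := (continuous_pathK (r := r) hG K).continuousAt.eventually_mem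
      ((isOpen_colsIn hCD.left.isOpen).mem_nhds hKC)
    have h2 := (continuous_pathL hG L).continuousAt.eventually_mem
      ((isOpen_rowsIn hCD.right.isOpen).mem_nhds hLD)
    filter_upwards [nhdsWithin_le_nhds h1, nhdsWithin_le_nhds h2] with y hy1 hy2
    exact ⟨fun hQ => hQ.transfer hU hM hCD hKC hLD hy1 hy2 (pathK_mul_pathL h hG hKL x),
      fun hQ => hQ.transfer hU hM hCD hy1 hy2 hKC hLD (pathK_mul_pathL h hG hKL y)⟩
  exact hiff.1 hstart

theorem posSSE_of_pos_eigenvectors (hU : Dense (U : Set ℝ)) (hM : OverU U M)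
    (h : IsSpectral M r u v N) [Fintype ι] [DecidableEq ι] [Nonempty ι] [Fintype κ]
    [DecidableEq κ] [Nonempty κ] {K : Matrix n ι ℝ} {L : Matrix ι n ℝ} {K' : Matrix n κ ℝ}
    {L' : Matrix κ n ℝ} (hK : OverU U K) (hL : OverU U L) (hK' : OverU U K') (hL' : OverU U L')
    (hKL : K * L = M) (hKL' : K' * L' = M) (hLK : ∀ i j, 0 < (L * K) i j)
    (hLK' : ∀ i j, 0 < (L' * K') i j) (hu : ∀ i j, 0 < (L * u) i j)
    (hv : ∀ i j, 0 < (v * K) i j) (hu' : ∀ i j, 0 < (L' * u) i j)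
    (hv' : ∀ i j, 0 < (v * K') i j) : PosSSE U (L * K) (L' * K') := by
  obtain ⟨G, hG⟩ := h.exists_isGrading
  have hev : ∀ {μ ν : Type} [Finite μ] [Finite ν] (A B : Matrix μ ν ℝ), (∀ i j, 0 < B i j) →
      ∀ᶠ t in Filter.atTop, ∀ i j, 0 < A i j + (Real.exp t * Real.exp t - 1) * B i j := by
    intro μ ν _ _ A B hB
    refine Filter.eventually_all.2 fun i => Filter.eventually_all.2 fun j => ?_
    filter_upwards [Filter.eventually_gt_atTop 0, Filter.eventually_gt_atTop (-A i j / B i j)]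
      with t h0 ht
    rw [div_lt_iff₀ (hB i j)] at ht
    have h1 := Real.add_one_le_exp t
    have h2 : t ≤ Real.exp t * Real.exp t - 1 := by nlinarith
    have := mul_le_mul_of_nonneg_right h2 (hB i j).le
    linarith
  obtain ⟨t, ⟨⟨⟨h1, h2⟩, h3⟩, h4⟩, ht⟩ :=
    ((((hev (L * K) _ (mul_entry_pos hu hv)).and (hev (L * K') _ (mul_entry_pos hu hv'))).and
      (hev (L' * K) _ (mul_entry_pos hu' hv))).and
      (hev (L' * K') _ (mul_entry_pos hu' hv'))).and (Filter.eventually_gt_atTop 0) |>.exists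
  have hpos : ∀ i j, 0 < (fromRows (pathL u v G L t) (pathL u v G L' t) *
      fromCols (pathK r u v G K t) (pathK r u v G K' t)) i j := by
    rw [fromRows_mul_fromCols]
    rintro (i | i) (j | j)
    exacts [pathL_mul_pathK_pos h hG hu hv ht h1 i j, pathL_mul_pathK_pos h hG hu hv' ht h2 i j,
      pathL_mul_pathK_pos h hG hu' hv ht h3 i j, pathL_mul_pathK_pos h hG hu' hv' ht h4 i j]
  obtain ⟨C, D, hCD, hC, hD⟩ := exists_isConePair hpos
  have hQ := repClass_path hU hM h hG hK hL hKL hLK hu hv ht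
  have hQ' := repClass_path hU hM h hG hK' hL' hKL' hLK' hu' hv' ht
  exact (hQ.transfer hU hM hCD (fun j => hC (Sum.inl j)) (fun i => hD (Sum.inl i))
    (fun j => hC (Sum.inr j)) (fun i => hD (Sum.inr i)) (pathK_mul_pathL h hG hKL t)).posSSE hU hM
    (pathK_mul_pathL h hG hKL' t) hQ'

theorem mul_pow_mul_eq {ι n : Type} [Fintype n] [DecidableEq n] [Fintype ι] [DecidableEq ι]
    (K : Matrix n ι ℝ) (L : Matrix ι n ℝ) (k : ℕ) : L * (K * L) ^ k * K = (L * K) ^ (k + 1) := by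
  induction k with
  | zero => simp
  | succ k ih =>
    rw [pow_succ (L * K), ← ih, pow_succ]
    simp only [Matrix.mul_assoc]

theorem pow_entry_pos {ι : Type} [Fintype ι] [DecidableEq ι] [Nonempty ι] {P : Matrix ι ι ℝ}
    (hP : ∀ i j, 0 < P i j) (k : ℕ) : ∀ i j, 0 < (P ^ (k + 1)) i j := by
  induction k with
  | zero => simpa using hP
  | succ k ih =>
    rw [pow_succ]
    exact mul_entry_pos ih hP

/-- After a change of sign, the eigenvectors are positive in any positive factorization. -/
theorem IsSpectral.exists_sign (h : IsSpectral M r u v N) [Fintype ι] [DecidableEq ι] [Nonempty ι]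
    {K : Matrix n ι ℝ} {L : Matrix ι n ℝ} (hK : OverU U K) (hL : OverU U L) (hKL : K * L = M)
    (hLK : ∀ i j, 0 < (L * K) i j) :
    ∃ (K' : Matrix n ι ℝ) (L' : Matrix ι n ℝ), OverU U K' ∧ OverU U L' ∧ K' * L' = M ∧
      L' * K' = L * K ∧ (∀ i j, 0 < (L' * u) i j) ∧ ∀ i j, 0 < (v * K') i j := by
  obtain ⟨k, -, hMk⟩ := h.exists_pow_eq
  have hprod : ∀ i j, 0 < (L * u) i () * (v * K) () j := by
    intro i j
    have h1 := pow_entry_pos hLK k i j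
    rw [← mul_pow_mul_eq, hKL, hMk, Matrix.mul_smul, Matrix.smul_mul, ← Matrix.mul_assoc L,
      Matrix.mul_assoc (L * u), Matrix.smul_apply, smul_eq_mul] at h1
    have h2 := (mul_pos_iff_of_pos_left (pow_pos h.pos k)).1 h1
    rwa [Matrix.mul_apply, Fintype.sum_unique] at h2
  let i₀ : ι := Classical.arbitrary ι
  rcases lt_or_ge 0 ((L * u) i₀ ()) with h0 | h0
  · have hv : ∀ j, 0 < (v * K) () j := fun j => (mul_pos_iff_of_pos_left h0).1 (hprod i₀ j)
    exact ⟨K, L, hK, hL, hKL, rfl, fun i _ => (mul_pos_iff_of_pos_right (hv i₀)).1 (hprod i i₀),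
      fun _ j => hv j⟩
  · have hv : ∀ j, (v * K) () j < 0 := fun j => by nlinarith [hprod i₀ j]
    refine ⟨-K, -L, hK.neg, hL.neg, by simpa using hKL, by simp, fun i j => ?_, fun i j => ?_⟩
    · rw [Matrix.neg_mul, Matrix.neg_apply]
      have h1 : (L * u) i j < 0 := by
        by_contra! hge
        have := mul_nonpos_of_nonneg_of_nonpos hge (hv i₀).le
        exact absurd (hprod i i₀) (not_lt.2 this)
      linarith
    · rw [Matrix.mul_neg, Matrix.neg_apply]
      exact neg_pos.2 (hv j)

/-- Positive factorizations over `U` of the same matrix give strong shift equivalent positive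
matrices. -/
theorem EventualRankOne.posSSE (hU : Dense (U : Set ℝ)) (hM : OverU U M)
    (h : EventualRankOne M) [Fintype ι] [DecidableEq ι] [Nonempty ι] [Fintype κ]
    [DecidableEq κ] [Nonempty κ] {K : Matrix n ι ℝ} {L : Matrix ι n ℝ} {K' : Matrix n κ ℝ}
    {L' : Matrix κ n ℝ} (hK : OverU U K) (hL : OverU U L) (hK' : OverU U K') (hL' : OverU U L')
    (hKL : K * L = M) (hKL' : K' * L' = M) (hLK : ∀ i j, 0 < (L * K) i j)
    (hLK' : ∀ i j, 0 < (L' * K') i j) : PosSSE U (L * K) (L' * K') := by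
  obtain ⟨r, u, v, N, hs⟩ := h.exists_isSpectral
  obtain ⟨K₁, L₁, hK₁, hL₁, hM₁, hP₁, hu₁, hv₁⟩ := hs.exists_sign hK hL hKL hLK
  obtain ⟨K₂, L₂, hK₂, hL₂, hM₂, hP₂, hu₂, hv₂⟩ := hs.exists_sign hK' hL' hKL' hLK'
  rw [← hP₁] at hLK ⊢
  rw [← hP₂] at hLK' ⊢
  exact posSSE_of_pos_eigenvectors hU hM hs hK₁ hL₁ hK₂ hL₂ hM₁ hM₂ hLK hLK' hu₁ hv₁ hu₂ hv₂

end Path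

/-- `M` has a factorization over `U` whose transposed product is positive and strong shift
equivalent to `Q` over the nonnegative part of `U`. -/
def Represents (U : Subring ℝ) {n ω : Type} [Fintype n] (M : Matrix n n ℝ) (Q : Matrix ω ω ℝ) :
    Prop :=
  ∃ (κ : Type) (_ : Fintype κ) (_ : DecidableEq κ) (_ : Nonempty κ) (K : Matrix n κ ℝ)
    (L : Matrix κ n ℝ), OverU U K ∧ OverU U L ∧ K * L = M ∧ (∀ i j, 0 < (L * K) i j) ∧
    PosSSE U (L * K) Q

section PositiveFactorization

variable {U : Subring ℝ} {n n' ω : Type} [Fintype n] [DecidableEq n] [Fintype n']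
  [DecidableEq n'] {M N : Matrix n n ℝ} {Q : Matrix ω ω ℝ} {r : ℝ} {u : Matrix n Unit ℝ}
  {v : Matrix Unit n ℝ}

theorem EventualRankOne.mul_comm {R : Matrix n n' ℝ} {S : Matrix n' n ℝ}
    (h : EventualRankOne (R * S)) : EventualRankOne (S * R) := by
  obtain ⟨⟨k, hk⟩, htr⟩ := h
  refine ⟨⟨k + 1, fun j hj => ?_⟩, by rwa [Matrix.trace_mul_comm]⟩
  obtain ⟨i, rfl⟩ : ∃ i, j = i + 1 := ⟨j - 1, by omega⟩
  refine le_antisymm ?_ ?_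
  · rw [← mul_pow_mul_eq]
    exact ((Matrix.rank_mul_le_left _ _).trans (Matrix.rank_mul_le_right _ _)).trans_eq
      (hk i (by omega))
  · refine (hk (i + 1 + 1) (by omega)).symm.trans_le ?_
    rw [← mul_pow_mul_eq]
    exact (Matrix.rank_mul_le_left _ _).trans (Matrix.rank_mul_le_right _ _)

theorem IsSpectral.exists_real_factorization (h : IsSpectral M r u v N) :
    ∃ (κ : Type) (_ : Fintype κ) (_ : DecidableEq κ) (_ : Nonempty κ) (K : Matrix n κ ℝ)
      (L : Matrix κ n ℝ), K * L = M ∧ ∀ i j, 0 < (L * K) i j := by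
  obtain ⟨G, hG⟩ := h.exists_isGrading
  have hpos : ∀ i j, 0 < (v * (r • u)) i j := fun i j => by
    rw [Matrix.mul_smul, h.vu]
    simpa using h.pos
  obtain ⟨C, D, hCD, hu, hv⟩ := exists_isConePair hpos
  have htop : Dense ((⊤ : Subring ℝ) : Set ℝ) := by simp
  have hc : Continuous fun s : ℝ => r • u * v + s • N := by fun_prop
  have hev := (hc.tendsto' 0 (r • u * v) (by simp)).eventually
    (hCD.eventually_exists_left htop hu hv)
  obtain ⟨s, hs, hs0⟩ := ((hev.filter_mono nhdsWithin_le_nhds).and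
    (self_mem_nhdsWithin (s := Set.Ioi (0 : ℝ)))).exists
  have hs0 : 0 < s := hs0
  obtain ⟨K, L, -, -, -, -, hK, hL, hKL, -⟩ := hs fun _ _ => trivial
  refine ⟨_, inferInstance, inferInstance, inferInstance, G (-Real.log s) * K,
    L * G (- -Real.log s), ?_, ?_⟩
  · have e : G (-Real.log s) * K * (L * G (- -Real.log s)) =
        G (-Real.log s) * (K * L) * G (- -Real.log s) := by
      simp only [Matrix.mul_assoc]
    have e1 : G (-Real.log s) * (r • u * v) * G (- -Real.log s) = r • (u * v) := by
      rw [Matrix.smul_mul, Matrix.mul_smul, ← Matrix.mul_assoc, hG.mul_u, Matrix.smul_mul,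
        Matrix.mul_assoc, hG.v_mul]
    have e2 : G (-Real.log s) * (s • N) * G (- -Real.log s) = N := by
      rw [Matrix.mul_smul, Matrix.smul_mul, hG.mul_N, Matrix.smul_mul, Matrix.mul_assoc,
        hG.mul_neg, Matrix.mul_one, smul_smul, Real.exp_neg, Real.exp_log hs0,
        mul_inv_cancel₀ hs0.ne', one_smul]
    rw [e, hKL, Matrix.mul_add, Matrix.add_mul, e1, e2, h.eq]
  · have e : L * G (- -Real.log s) * (G (-Real.log s) * K) =
        L * (G (- -Real.log s) * G (-Real.log s)) * K := by
      simp only [Matrix.mul_assoc]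
    rw [e, hG.neg_mul, Matrix.mul_one]
    exact hCD.mul_pos hK hL

theorem EventualRankOne.exists_left (hU : Dense (U : Set ℝ)) (hM : OverU U M)
    (h : EventualRankOne M) :
    ∃ (κ : Type) (_ : Fintype κ) (_ : DecidableEq κ) (_ : Nonempty κ) (K : Matrix n κ ℝ)
      (L : Matrix κ n ℝ) (F : Matrix n κ ℝ), OverU U K ∧ OverU U L ∧ OverU U F ∧ K * L = M ∧
      (∀ i j, 0 < (L * K) i j) ∧ F * L = 1 := by
  obtain ⟨r, u, v, N, hs⟩ := h.exists_isSpectral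
  obtain ⟨κ, _, _, _, K, L, rfl, hpos⟩ := hs.exists_real_factorization
  obtain ⟨C, D, hCD, hK, hL⟩ := exists_isConePair hpos
  obtain ⟨K', L', F, hK', hL', hF, hK'C, hL'D, hKL, hFL⟩ :=
    (hCD.eventually_exists_left hU hK hL).self_of_nhds hM
  exact ⟨_, inferInstance, inferInstance, inferInstance, K', L', F, hK', hL', hF, hKL,
    hCD.mul_pos hK'C hL'D, hFL⟩

theorem EventualRankOne.exists_right (hU : Dense (U : Set ℝ)) (hM : OverU U M)
    (h : EventualRankOne M) :
    ∃ (κ : Type) (_ : Fintype κ) (_ : DecidableEq κ) (_ : Nonempty κ) (K : Matrix n κ ℝ)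
      (L : Matrix κ n ℝ) (E : Matrix κ n ℝ), OverU U K ∧ OverU U L ∧ OverU U E ∧ K * L = M ∧
      (∀ i j, 0 < (L * K) i j) ∧ K * E = 1 := by
  obtain ⟨r, u, v, N, hs⟩ := h.exists_isSpectral
  obtain ⟨κ, _, _, _, K, L, rfl, hpos⟩ := hs.exists_real_factorization
  obtain ⟨C, D, hCD, hK, hL⟩ := exists_isConePair hpos
  obtain ⟨K', L', E, hK', hL', hE, hK'C, hL'D, hKL, hKE⟩ :=
    (hCD.eventually_exists_right hU hK hL).self_of_nhds hM
  exact ⟨_, inferInstance, inferInstance, inferInstance, K', L', E, hK', hL', hE, hKL,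
    hCD.mul_pos hK'C hL'D, hKE⟩

theorem Represents.mul_comm (hU : Dense (U : Set ℝ)) {R : Matrix n n' ℝ} {S : Matrix n' n ℝ}
    (hR : OverU U R) (hS : OverU U S) (h : EventualRankOne (R * S))
    (hQ : Represents U (R * S) Q) : Represents U (S * R) Q := by
  obtain ⟨κ₀, _, _, _, K₀, L₀, hK₀, hL₀, hM₀, hP₀, hPQ⟩ := hQ
  obtain ⟨κ, _, _, _, K, L, F, hK, hL, hF, hKL, hP, hFL⟩ := h.exists_left hU (hR.mul hS)
  obtain ⟨κ', _, _, _, K', L', E, hK', hL', hE, hKL', hP', hKE⟩ :=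
    h.mul_comm.exists_right hU (hS.mul hR)
  refine ⟨κ', ‹_›, ‹_›, ‹_›, K', L', hK', hL', hKL', hP', ?_⟩
  refine PosSSE.trans ?_ ((h.posSSE hU (hR.mul hS) hK hL hK₀ hL₀ hKL hM₀ hP hP₀).trans hPQ)
  set V : Matrix (n ⊕ n') n' ℝ := fromRows 0 1 with hV
  set W : Matrix n' (n ⊕ n') ℝ := fromCols S (S * R) with hW
  have hVU : OverU U V := OverU.zero.fromRows .one
  have hWU : OverU U W := hS.fromCols (hS.mul hR)
  have hWV : W * V = S * R := by rw [hV, hW, fromCols_mul_fromRows]; simp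
  have hVW : EventualRankOne (V * W) := by
    refine EventualRankOne.mul_comm ?_
    rw [hWV]
    exact h.mul_comm
  have e1 : L' * K' = fromCols (E * S) L' * fromRows (0 : Matrix n κ' ℝ) K' := by
    rw [fromCols_mul_fromRows]; simp
  have e2 : L * K = fromCols L (L * R) * fromRows (K - R * S * F) (S * F) := by
    rw [fromCols_mul_fromRows, Matrix.mul_sub]
    simp only [Matrix.mul_assoc, sub_add_cancel]
  have e3 : fromRows (0 : Matrix n κ' ℝ) K' * fromCols (E * S) L' = V * W := by
    rw [hV, hW, fromRows_mul_fromCols, fromRows_mul_fromCols, ← Matrix.mul_assoc K', hKE, hKL']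
    simp
  have e4 : fromRows (K - R * S * F) (S * F) * fromCols L (L * R) = V * W := by
    have a1 : (K - R * S * F) * L = 0 := by
      rw [Matrix.sub_mul, hKL, Matrix.mul_assoc, hFL, Matrix.mul_one, sub_self]
    have a2 : S * F * L = S := by rw [Matrix.mul_assoc, hFL, Matrix.mul_one]
    rw [hV, hW, fromRows_mul_fromCols, fromRows_mul_fromCols, ← Matrix.mul_assoc,
      ← Matrix.mul_assoc, a1, a2]
    simp
  rw [e1] at hP' ⊢
  rw [e2] at hP ⊢
  exact hVW.posSSE hU (hVU.mul hWU) (OverU.zero.fromRows hK') ((hE.mul hS).fromCols hL')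
    ((hK.sub ((hR.mul hS).mul hF)).fromRows (hS.mul hF)) (hL.fromCols (hL.mul hR)) e3 e4 hP' hP

theorem represents_self [Nonempty n] (hM : OverU U M) (hpos : ∀ i j, 0 < M i j) :
    Represents U M M :=
  ⟨n, ‹_›, ‹_›, ‹_›, M, 1, hM, .one, by simp, by simpa using hpos, by
    rw [Matrix.one_mul]
    exact .refl hM fun i j => (hpos i j).le⟩

theorem SSE.eventualRankOne {S : Set ℝ} {p q : (n : ℕ) × Matrix (Fin n) (Fin n) ℝ}
    (h : SSE S p q) (hp : EventualRankOne p.2) : EventualRankOne q.2 := by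
  induction h with
  | refl => exact hp
  | tail _ h ih =>
    obtain ⟨R, T, -, -, h1, h2⟩ := h
    rw [h1] at ih
    rw [h2]
    exact ih.mul_comm

theorem SSE.represents (hU : Dense (U : Set ℝ)) {p q : (n : ℕ) × Matrix (Fin n) (Fin n) ℝ}
    (h : SSE (U : Set ℝ) p q) (hp : EventualRankOne p.2) (hQ : Represents U p.2 Q) :
    Represents U q.2 Q := by
  induction h with
  | refl => exact hQ
  | tail h' h ih =>
    obtain ⟨R, T, hR, hT, h1, h2⟩ := h
    have h3 := SSE.eventualRankOne h' hp
    rw [h1] at h3 ih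
    rw [h2]
    exact ih.mul_comm hU hR hT h3

theorem Represents.posSSE (hU : Dense (U : Set ℝ)) [Nonempty n] (hM : OverU U M)
    (h : EventualRankOne M) (hpos : ∀ i j, 0 < M i j) (hQ : Represents U M Q) :
    PosSSE U M Q := by
  obtain ⟨κ, _, _, _, K, L, hK, hL, hKL, hP, hPQ⟩ := hQ
  have := h.posSSE hU hM hM .one hK hL (by simp) hKL (by simpa using hpos) hP
  rw [Matrix.one_mul] at this
  exact this.trans hPQ

end PositiveFactorization

/-- Nonnegative matrices over `U`, of eventual rank one, without zero rows or columns. -/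
structure IsNonnegReduced (U : Subring ℝ) {n : Type} [Fintype n] [DecidableEq n] (P : Matrix n n ℝ) :
    Prop where
  overU : OverU U P
  nonneg : ∀ i j, 0 ≤ P i j
  rank : EventualRankOne P
  row : ∀ i, ∃ j, 0 < P i j
  col : ∀ j, ∃ i, 0 < P i j

section Positivization

variable {U : Subring ℝ} {n ι κ μ : Type} [Fintype n] [DecidableEq n] {P : Matrix n n ℝ}

theorem mul_entry_pos_of_entries [Fintype κ] {K : Matrix ι κ ℝ} {L : Matrix κ μ ℝ} (hK : ∀ i j, 0 ≤ K i j)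
    (hL : ∀ i j, 0 ≤ L i j) {i : ι} {a : κ} {j : μ} (h1 : 0 < K i a) (h2 : 0 < L a j) :
    0 < (K * L) i j :=
  (mul_pos h1 h2).trans_le <| Finset.single_le_sum (f := fun a => K i a * L a j)
    (fun a _ => mul_nonneg (hK i a) (hL a j)) (Finset.mem_univ a)

theorem IsNonnegReduced.exists_pow_pos (h : IsNonnegReduced U P) : ∃ k : ℕ, ∀ i j, 0 < (P ^ k) i j := by
  have hrow : ∀ k i, ∃ j, 0 < (P ^ k) i j := by
    intro k
    induction k with
    | zero => exact fun i => ⟨i, by simp⟩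
    | succ k ih =>
      intro i
      obtain ⟨a, ha⟩ := ih i
      obtain ⟨j, hj⟩ := h.row a
      exact ⟨j, by rw [pow_succ]; exact mul_entry_pos_of_entries (pow_apply_nonneg h.nonneg k) h.nonneg ha hj⟩
  have hcol : ∀ k j, ∃ i, 0 < (P ^ k) i j := by
    intro k
    induction k with
    | zero => exact fun i => ⟨i, by simp⟩
    | succ k ih =>
      intro j
      obtain ⟨a, ha⟩ := ih j
      obtain ⟨i, hi⟩ := h.col a
      exact ⟨i, by rw [pow_succ']; exact mul_entry_pos_of_entries h.nonneg (pow_apply_nonneg h.nonneg k) hi ha⟩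
  obtain ⟨r, u, v, N, hs⟩ := h.rank.exists_isSpectral
  obtain ⟨k, -, hk⟩ := hs.exists_pow_eq
  have hent : ∀ i j, (P ^ k) i j = r ^ k * (u i () * v () j) := fun i j => by
    rw [hk]; simp [Matrix.mul_apply]
  refine ⟨k, fun i j => lt_of_le_of_ne (pow_apply_nonneg h.nonneg k i j) ?_⟩
  obtain ⟨a, ha⟩ := hrow k i
  obtain ⟨b, hb⟩ := hcol k j
  rw [hent] at ha hb ⊢
  have h1 : u i () ≠ 0 := by rintro h0; simp [h0] at ha
  have h2 : v () j ≠ 0 := by rintro h0; simp [h0] at hb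
  exact (mul_ne_zero (pow_pos hs.pos k).ne' (mul_ne_zero h1 h2)).symm

theorem IsNonnegReduced.exists_entry_pos (h : IsNonnegReduced U P) {S : Set n} {a b : n} (ha : a ∈ S)
    (hb : b ∉ S) : ∃ i ∈ S, ∃ j ∉ S, 0 < P i j := by
  by_contra! hne
  have h0 : ∀ k, ∀ i ∈ S, ∀ j ∉ S, (P ^ k) i j = 0 := by
    intro k
    induction k with
    | zero =>
      intro i hi j hj
      rw [pow_zero, Matrix.one_apply_ne]
      rintro rfl
      exact hj hi
    | succ k ih =>
      intro i hi j hj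
      rw [pow_succ, Matrix.mul_apply]
      refine Finset.sum_eq_zero fun l _ => ?_
      by_cases hl : l ∈ S
      · rw [(hne l hl j hj).antisymm (h.nonneg l j), mul_zero]
      · rw [ih i hi l hl, zero_mul]
  obtain ⟨k, hk⟩ := h.exists_pow_pos
  exact (hk a b).ne' (h0 k a ha b hb)

omit [Fintype n] [DecidableEq n] in
theorem eventually_entries_pos [Finite n] {F : ℝ → Matrix n n ℝ} (hF : Continuous F) :
    ∀ᶠ s in nhds 0, ∀ i j, 0 < F 0 i j → 0 < F s i j := by
  refine Filter.eventually_all.2 fun i => Filter.eventually_all.2 fun j => ?_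
  by_cases h : 0 < F 0 i j
  · filter_upwards [((hF.matrix_elem i j).tendsto 0).eventually (lt_mem_nhds h)] with s hs _
    exact hs
  · exact .of_forall fun s h' => absurd h' h

theorem exists_isNonnegReduced (hP : OverU U P) (hP0 : ∀ i j, 0 ≤ P i j) (hr : EventualRankOne P) :
    ∃ (κ : Type) (_ : Fintype κ) (_ : DecidableEq κ) (P' : Matrix κ κ ℝ),
      IsNonnegReduced U P' ∧ PosSSE U P P' := by
  induction hN : Fintype.card n using Nat.strong_induction_on generalizing n with
  | _ N ih =>
    subst hN
    have of_factor : ∀ (i : n) (R : Matrix n {j // j ≠ i} ℝ) (T : Matrix {j // j ≠ i} n ℝ),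
        OverU U R → OverU U T → (∀ a b, 0 ≤ R a b) → (∀ a b, 0 ≤ T a b) → P = R * T →
        ∃ (κ : Type) (_ : Fintype κ) (_ : DecidableEq κ) (P' : Matrix κ κ ℝ),
          IsNonnegReduced U P' ∧ PosSSE U P P' := by
      rintro i R T hR hT hR0 hT0 rfl
      obtain ⟨κ, _, _, P', h1, h2⟩ := ih _
        (Fintype.card_subtype_lt (p := fun j => j ≠ i) (x := i) (by simp))
        (hT.mul hR) (mul_entry_nonneg hT0 hR0) hr.mul_comm rfl
      exact ⟨κ, _, _, P', h1, (PosSSE.of_mul hR hT hR0 hT0).trans h2⟩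
    have hone : ∀ a b : n, (0 : ℝ) ≤ (1 : Matrix n n ℝ) a b := fun a b => by
      rw [Matrix.one_apply]; split_ifs <;> norm_num
    by_cases hrow : ∀ i, ∃ j, 0 < P i j
    · by_cases hcol : ∀ j, ∃ i, 0 < P i j
      · exact ⟨n, _, _, P, ⟨hP, hP0, hr, hrow, hcol⟩, .refl hP hP0⟩
      · push Not at hcol
        obtain ⟨i, hi⟩ := hcol
        refine of_factor i (P.submatrix id (↑)) ((1 : Matrix n n ℝ).submatrix (↑) id)
          (hP.submatrix _ _) (OverU.one.submatrix _ _) (fun _ _ => hP0 _ _) (fun _ _ => hone _ _) ?_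
        ext a b
        rw [Matrix.mul_apply]
        by_cases hb : b = i
        · subst hb
          rw [Finset.sum_eq_zero, (hi a).antisymm (hP0 a b)]
          intro l _
          rw [Matrix.submatrix_apply _ _ _ l, id, Matrix.one_apply_ne l.2, mul_zero]
        · rw [Finset.sum_eq_single ⟨b, hb⟩]
          · exact (by simp : P a b = P a b * (1 : Matrix n n ℝ) b b)
          · rintro l - hl
            have : (l : n) ≠ b := fun h => hl (Subtype.ext h)
            simp [this]
          · simp
    · push Not at hrow
      obtain ⟨i, hi⟩ := hrow
      refine of_factor i ((1 : Matrix n n ℝ).submatrix id (↑)) (P.submatrix (↑) id)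
        (OverU.one.submatrix _ _) (hP.submatrix _ _) (fun _ _ => hone _ _) (fun _ _ => hP0 _ _) ?_
      ext a b
      rw [Matrix.mul_apply]
      by_cases ha : a = i
      · subst ha
        rw [Finset.sum_eq_zero, (hi b).antisymm (hP0 a b)]
        intro l _
        rw [Matrix.submatrix_apply, id, Matrix.one_apply_ne l.2.symm, zero_mul]
      · rw [Finset.sum_eq_single ⟨a, ha⟩]
        · exact (by simp : P a b = (1 : Matrix n n ℝ) a a * P a b)
        · rintro l - hl
          have : a ≠ (l : n) := fun h => hl (Subtype.ext h.symm)
          simp [this]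
        · simp

theorem IsNonnegReduced.exists_full_row (hU : Dense (U : Set ℝ)) (h : IsNonnegReduced U P) {w : n}
    (hw : 0 < P w w) :
    ∃ (κ : Type) (_ : Fintype κ) (_ : DecidableEq κ) (P' : Matrix κ κ ℝ),
      IsNonnegReduced U P' ∧ PosSSE U P P' ∧ ∃ f, ∀ j, 0 < P' f j := by
  classical
  induction hN : (Finset.univ.filter fun j => ¬ 0 < P w j).card using Nat.strong_induction_on
    generalizing n with
  | _ N ih =>
    subst hN
    by_cases hfull : ∀ j, 0 < P w j
    · exact ⟨n, _, _, P, h, .refl h.overU h.nonneg, w, hfull⟩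
    obtain ⟨b, hb⟩ := not_forall.1 hfull
    obtain ⟨i, hi, t, ht, hit⟩ := h.exists_entry_pos (S := {j | 0 < P w j}) hw hb
    set x : Matrix n Unit ℝ := Matrix.of fun i _ => if i = w then 1 else 0 with hx
    set y : Matrix Unit n ℝ := Matrix.of fun _ j => if 0 < P w j then 1 else 0 with hy
    have hc : Continuous fun s : ℝ => P - s • (x * y) := by fun_prop
    obtain ⟨δ, hδU, hδ, hpos⟩ := exists_pos_mem_of_eventually hU (eventually_entries_pos hc)
    simp only [zero_smul, sub_zero] at hpos
    have hxy : ∀ i j, (x * y) i j = if i = w ∧ 0 < P w j then 1 else 0 := fun i j => by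
      simp only [hx, hy, Matrix.mul_apply, Matrix.of_apply, Finset.univ_unique,
        Finset.sum_singleton, ite_and]
      split_ifs <;> simp
    have hP0 : ∀ i j, 0 ≤ (P - δ • (x * y)) i j := fun i j => by
      rcases (h.nonneg i j).lt_or_eq with h0 | h0
      · exact (hpos i j h0).le
      · rw [Matrix.sub_apply, Matrix.smul_apply, hxy, if_neg]
        · simp [← h0]
        · rintro ⟨rfl, h1⟩
          exact h1.ne h0
    set P₀ := P - δ • (x * y) with hP₀
    have hx0 : ∀ i j, 0 ≤ x i j := fun i j => by simp only [hx, Matrix.of_apply]; split_ifs <;> simp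
    have hy0 : ∀ i j, 0 ≤ y i j := fun i j => by simp only [hy, Matrix.of_apply]; split_ifs <;> simp
    have hxU : OverU U x := fun i j => by
      simp only [hx, Matrix.of_apply]; split_ifs
      exacts [one_mem _, zero_mem _]
    have hyU : OverU U y := fun i j => by
      simp only [hy, Matrix.of_apply]; split_ifs
      exacts [one_mem _, zero_mem _]
    have hPU : OverU U P₀ := h.overU.sub ((hxU.mul hyU).smul hδU)
    have hyw : ∀ {j}, 0 < P w j → 0 < y () j := fun hj => by simp [hy, hj]
    have hKL : P = fromCols P₀ (δ • x) * fromRows (1 : Matrix n n ℝ) y := by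
      rw [fromCols_mul_fromRows, Matrix.mul_one, Matrix.smul_mul, hP₀, sub_add_cancel]
    have hLK : fromRows (1 : Matrix n n ℝ) y * fromCols P₀ (δ • x) =
        fromBlocks P₀ (δ • x) (y * P₀) (δ • (y * x)) := by
      rw [fromRows_mul_fromCols, Matrix.one_mul, Matrix.one_mul, Matrix.mul_smul]
    set P' : Matrix (n ⊕ Unit) (n ⊕ Unit) ℝ :=
      fromBlocks P₀ (δ • x) (y * P₀) (δ • (y * x)) with hP'
    have hwx : 0 < x w () := by simp [hx]
    have hzz : 0 < P' (.inr ()) (.inr ()) :=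
      mul_pos hδ (mul_entry_pos_of_entries hy0 hx0 (hyw hw) hwx)
    have hred : IsNonnegReduced U P' := by
      refine ⟨?_, ?_, ?_, ?_, ?_⟩
      · rw [← hLK]
        exact (OverU.one.fromRows hyU).mul (hPU.fromCols (hxU.smul hδU))
      · rintro (i | i) (j | j)
        exacts [hP0 i j, mul_nonneg hδ.le (hx0 i j), mul_entry_nonneg hy0 hP0 i j,
          mul_nonneg hδ.le (mul_entry_nonneg hy0 hx0 i j)]
      · rw [← hLK]
        refine EventualRankOne.mul_comm ?_
        rw [← hKL]
        exact h.rank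
      · rintro (i | i)
        · obtain ⟨j, hj⟩ := h.row i
          exact ⟨.inl j, hpos i j hj⟩
        · exact ⟨.inr (), hzz⟩
      · rintro (j | j)
        · obtain ⟨i, hi⟩ := h.col j
          exact ⟨.inl i, hpos i j hi⟩
        · exact ⟨.inr (), hzz⟩
    have hsse : PosSSE U P P' := by
      refine .of_eq_mul _ _ hKL hLK.symm (hPU.fromCols (hxU.smul hδU)) (OverU.one.fromRows hyU)
        ?_ ?_
      · rintro i (j | j)
        exacts [hP0 i j, mul_nonneg hδ.le (hx0 i j)]
      · rintro (i | i) j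
        · rw [fromRows_apply_inl, Matrix.one_apply]
          split_ifs <;> norm_num
        · exact hy0 i j
    have hz : ∀ {s j}, 0 < P w s → 0 < P s j → 0 < P' (.inr ()) (.inl j) := fun hs hj =>
      mul_entry_pos_of_entries hy0 hP0 (hyw hs) (hpos _ _ hj)
    have hsub : (Finset.univ.filter fun j => ¬ 0 < P' (.inr ()) j) ⊆
        ((Finset.univ.filter fun j => ¬ 0 < P w j).erase t).image Sum.inl := by
      rintro (j | j) hj
      · rw [Finset.mem_filter] at hj
        refine Finset.mem_image_of_mem _ (Finset.mem_erase.2 ⟨?_, ?_⟩)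
        · rintro rfl
          exact hj.2 (hz hi hit)
        · exact Finset.mem_filter.2 ⟨Finset.mem_univ _, fun h0 => hj.2 (hz hw h0)⟩
      · exact absurd hzz (Finset.mem_filter.1 hj).2
    have hlt := ((Finset.card_le_card hsub).trans Finset.card_image_le).trans_lt
      (Finset.card_erase_lt_of_mem (Finset.mem_filter.2 ⟨Finset.mem_univ _, ht⟩))
    obtain ⟨κ, _, _, P'', h1, h2, h3⟩ := ih _ hlt hred hzz rfl
    exact ⟨κ, _, _, P'', h1, hsse.trans h2, h3⟩

theorem IsNonnegReduced.exists_pos (hU : Dense (U : Set ℝ)) (h : IsNonnegReduced U P)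
    (hfull : ∃ f, ∀ j, 0 < P f j) :
    ∃ P' : Matrix n n ℝ, IsNonnegReduced U P' ∧ PosSSE U P P' ∧ ∀ i j, 0 < P' i j := by
  classical
  induction hN : (Finset.univ.filter fun i => ¬ ∀ j, 0 < P i j).card
    using Nat.strong_induction_on generalizing P with
  | _ N ih =>
    subst hN
    by_cases hall : ∀ i j, 0 < P i j
    · exact ⟨P, h, .refl h.overU h.nonneg, hall⟩
    obtain ⟨a, ha⟩ := not_forall.1 hall
    obtain ⟨b, hb⟩ := hfull
    obtain ⟨i, hi, f, hf, hif⟩ := h.exists_entry_pos (S := {i | ¬ ∀ j, 0 < P i j}) ha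
      (not_not.2 hb)
    replace hf : ∀ j, 0 < P f j := not_not.1 hf
    set X : Matrix n n ℝ := Matrix.of fun a b => if a = f ∧ b ≠ f then 1 else 0 with hX
    have hXX : X * X = 0 := by
      ext a b
      rw [Matrix.mul_apply]
      refine Finset.sum_eq_zero fun l _ => ?_
      by_cases hl : l = f <;> simp [hX, hl]
    have hXP : ∀ a ≠ f, ∀ b, (X * P) a b = 0 := fun a ha b => by
      rw [Matrix.mul_apply]
      exact Finset.sum_eq_zero fun l _ => by simp [hX, ha]
    have hXU : OverU U X := fun i j => by
      simp only [hX, Matrix.of_apply]; split_ifs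
      exacts [one_mem _, zero_mem _]
    have hX0 : ∀ i j, 0 ≤ X i j := fun i j => by
      simp only [hX, Matrix.of_apply]; split_ifs <;> simp
    have hc : Continuous fun s : ℝ => P - s • (X * P) := by fun_prop
    obtain ⟨ε, hεU, hε, hpos⟩ := exists_pos_mem_of_eventually hU (eventually_entries_pos hc)
    simp only [zero_smul, sub_zero] at hpos
    set R := P - ε • (X * P) with hR
    have hR0 : ∀ i j, 0 ≤ R i j := fun i j => by
      by_cases hi : i = f
      · exact (hpos i j (hi ▸ hf j)).le
      · rw [hR, Matrix.sub_apply, Matrix.smul_apply, hXP i hi]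
        simpa using h.nonneg i j
    have hRU : OverU U R := h.overU.sub ((hXU.mul h.overU).smul hεU)
    have hE : ∀ i j, (1 + ε • X) i j = (1 : Matrix n n ℝ) i j + ε * X i j := fun _ _ => rfl
    have hone : ∀ a b : n, (0 : ℝ) ≤ (1 : Matrix n n ℝ) a b := fun a b => by
      rw [Matrix.one_apply]; split_ifs <;> norm_num
    have hE0 : ∀ i j, 0 ≤ (1 + ε • X) i j := fun i j => by
      rw [hE]
      exact add_nonneg (hone i j) (mul_nonneg hε.le (hX0 i j))
    have hEd : ∀ i, 0 < (1 + ε • X) i i := fun i => by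
      rw [hE, Matrix.one_apply_eq]
      exact add_pos_of_pos_of_nonneg one_pos (mul_nonneg hε.le (hX0 i i))
    have hEf : ∀ j, 0 < (1 + ε • X) f j := fun j => by
      by_cases hj : j = f
      · rw [hj]
        exact hEd f
      · rw [hE]
        exact add_pos_of_nonneg_of_pos (hone f j) (mul_pos hε (by simp [hX, hj]))
    have hEU : OverU U (1 + ε • X) := OverU.one.add (hXU.smul hεU)
    have hER : P = (1 + ε • X) * R := by
      rw [hR, Matrix.add_mul, Matrix.one_mul, Matrix.mul_sub, Matrix.smul_mul, Matrix.smul_mul,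
        Matrix.mul_smul, ← Matrix.mul_assoc X X, hXX, Matrix.zero_mul]
      simp
    have hgrow : ∀ {i j}, 0 < P i j → 0 < (R * (1 + ε • X)) i j := fun hij =>
      mul_entry_pos_of_entries hR0 hE0 (hpos _ _ hij) (hEd _)
    have hred : IsNonnegReduced U (R * (1 + ε • X)) := by
      refine ⟨hRU.mul hEU, mul_entry_nonneg hR0 hE0, ?_, fun i => ?_, fun j => ?_⟩
      · refine EventualRankOne.mul_comm ?_
        rw [← hER]
        exact h.rank
      · exact (h.row i).imp fun j hj => hgrow hj
      · exact (h.col j).imp fun j hj => hgrow hj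
    have hlt : (Finset.univ.filter fun i => ¬ ∀ j, 0 < (R * (1 + ε • X)) i j).card <
        (Finset.univ.filter fun i => ¬ ∀ j, 0 < P i j).card := by
      refine Finset.card_lt_card (Finset.ssubset_iff.2 ⟨i, ?_, ?_⟩)
      · rw [Finset.mem_filter]
        exact fun h0 => h0.2 fun j => mul_entry_pos_of_entries hR0 hE0 (hpos i f hif) (hEf j)
      · refine Finset.insert_subset (Finset.mem_filter.2 ⟨Finset.mem_univ _, hi⟩) fun l hl => ?_
        rw [Finset.mem_filter] at hl ⊢
        exact ⟨hl.1, fun h0 => hl.2 fun j => hgrow (h0 j)⟩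
    obtain ⟨P', h1, h2, h3⟩ := ih _ hlt hred ⟨f, fun j => hgrow (hf j)⟩ rfl
    exact ⟨P', h1, (PosSSE.of_eq_mul _ _ hER rfl hEU hRU hE0 hR0).trans h2, h3⟩

theorem exists_pos_posSSE (hU : Dense (U : Set ℝ)) (hP : OverU U P) (hP0 : ∀ i j, 0 ≤ P i j)
    (hr : EventualRankOne P) :
    ∃ (κ : Type) (_ : Fintype κ) (_ : DecidableEq κ) (P' : Matrix κ κ ℝ),
      IsNonnegReduced U P' ∧ PosSSE U P P' ∧ ∀ i j, 0 < P' i j := by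
  obtain ⟨κ, _, _, P₁, h₁, hs₁⟩ := exists_isNonnegReduced hP hP0 hr
  obtain ⟨w, -, hw⟩ := Finset.exists_lt_of_sum_lt
    (s := Finset.univ) (f := fun _ : κ => (0 : ℝ)) (g := fun i => P₁ i i) (by
      simpa [Matrix.trace] using h₁.rank.2)
  obtain ⟨κ', _, _, P₂, h₂, hs₂, hf⟩ := h₁.exists_full_row hU hw
  obtain ⟨P₃, h₃, hs₃, hpos⟩ := h₂.exists_pos hU hf
  exact ⟨κ', _, _, P₃, h₃, (hs₁.trans hs₂).trans hs₃, hpos⟩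

theorem exists_pos_sse (hU : Dense (U : Set ℝ)) {m : ℕ} {A : Matrix (Fin m) (Fin m) ℝ}
    (hA : OverU U A) (hA0 : ∀ i j, 0 ≤ A i j) (hr : ∃ k : ℕ, ∀ j ≥ k, (A ^ j).rank = 1) :
    ∃ (k : ℕ) (P : Matrix (Fin k) (Fin k) ℝ), Nonempty (Fin k) ∧ OverU U P ∧ EventualRankOne P ∧
      (∀ i j, 0 < P i j) ∧ SSE {x : ℝ | x ∈ U ∧ 0 ≤ x} ⟨m, A⟩ ⟨k, P⟩ := by
  have hA' := EventualRankOne.of_nonneg hr hA0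
  obtain ⟨κ, _, _, P, h, hs, hpos⟩ := exists_pos_posSSE hU hA hA0 hA'
  have hs' := hs m _ (Equiv.refl _) (Fintype.equivFin κ)
  have hP := SSE.eventualRankOne hs' hA'
  refine ⟨_, _, ?_, h.overU.submatrix _ _, hP, fun _ _ => hpos _ _, hs'⟩
  by_contra hne
  rw [not_nonempty_iff] at hne
  simpa [Matrix.trace] using hP.2

theorem SSE.mono {S T : Set ℝ} (hST : S ⊆ T) {p q : (n : ℕ) × Matrix (Fin n) (Fin n) ℝ}
    (h : SSE S p q) : SSE T p q :=
  Relation.ReflTransGen.mono (fun _ _ ⟨R, R', h1, h2, h3⟩ =>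
    ⟨R, R', fun i j => hST (h1 i j), fun i j => hST (h2 i j), h3⟩) _ _ h

end Positivization

/-- Nonnegative eventually-rank-one matrices over a nondiscrete unital subring `U` of
`ℝ` which are strong shift equivalent over `U` are strong shift equivalent over `U₊`. -/
theorem one_eigenvalue_theorem (U : Subring ℝ) (hU : Dense (U : Set ℝ))
    {m k : ℕ} (A : Matrix (Fin m) (Fin m) ℝ) (B : Matrix (Fin k) (Fin k) ℝ)
    (hAU : entriesIn (U : Set ℝ) A) (hBU : entriesIn (U : Set ℝ) B)
    (hAnn : ∀ i j, 0 ≤ A i j) (hBnn : ∀ i j, 0 ≤ B i j)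
    (hArk : ∃ K : ℕ, ∀ j ≥ K, (A ^ j).rank = 1)
    (hBrk : ∃ K : ℕ, ∀ j ≥ K, (B ^ j).rank = 1)
    (hsse : SSE (U : Set ℝ) ⟨m, A⟩ ⟨k, B⟩) :
    SSE {x : ℝ | x ∈ U ∧ 0 ≤ x} ⟨m, A⟩ ⟨k, B⟩ := by
  have hmono : {x : ℝ | x ∈ U ∧ 0 ≤ x} ⊆ (U : Set ℝ) := fun _ hx => hx.1
  obtain ⟨a, P, _, hPU, hP, hPpos, hAP⟩ := exists_pos_sse hU hAU hAnn hArk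
  obtain ⟨b, Q, _, hQU, hQ, hQpos, hBQ⟩ := exists_pos_sse hU hBU hBnn hBrk
  have hPQ : SSE (U : Set ℝ) ⟨a, P⟩ ⟨b, Q⟩ :=
    ((hAP.symm.mono hmono).trans hsse).trans (hBQ.mono hmono)
  have hrep : Represents U Q P := SSE.represents hU hPQ hP (represents_self hPU hPpos)
  exact (hAP.trans (hrep.posSSE hU hQU hQ hQpos).symm.sse).trans hBQ.symm
end
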